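/- Let X be a locally geodesic metric space homeomorphic to ℝ². If X has locally finite Hausdorff 2-measure, then X contains a 2-rectifiable subset of positive Hausdorff 2-measure. -/

import Mathlib

noncomputable section

/-- The Euclidean plane `ℝ²`. -/
abbrev E2 : Type := EuclideanSpace ℝ (Fin 2)

/-- The open unit disc `D ⊆ ℝ²`. -/
def unitDisc : Set E2 := Metric.ball 0 1

/-- The closed unit disc `D̄ ⊆ ℝ²`. -/
def unitClosedDisc : Set E2 := Metric.closedBall 0 1

/-- The unit circle `S¹ ⊆ ℝ²`. -/
def unitCircle : Set E2 := Metric.sphere 0 1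

/-- A curve in a metric space: a function which is continuous on a compact interval `[a,b]`. -/
structure MCurve (X : Type*) [PseudoEMetricSpace X] where
  a : ℝ
  b : ℝ
  hab : a ≤ b
  toFun : ℝ → X
  cont : ContinuousOn toFun (Set.Icc a b)

/-- The length of a curve, i.e. its total variation. -/
def MCurve.length {X : Type*} [PseudoEMetricSpace X] (γ : MCurve X) : ENNReal :=
  eVariationOn γ.toFun (Set.Icc γ.a γ.b)

/-- A metric space is geodesic if any two points are joined by a curve whose length equals
their distance. -/
def IsGeodesicSpace (X : Type*) [MetricSpace X] : Prop :=
  ∀ x y : X, ∃ γ : MCurve X, γ.toFun γ.a = x ∧ γ.toFun γ.b = y ∧ γ.length = edist x y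

/-- A metric space is locally geodesic if every point has a neighborhood `U` such that any two
points of `U` are joined by a geodesic in `X`. -/
def IsLocallyGeodesicSpace (X : Type*) [MetricSpace X] : Prop :=
  ∀ x : X, ∃ U ∈ nhds x, ∀ y ∈ U, ∀ z ∈ U,
    ∃ γ : MCurve X, γ.toFun γ.a = y ∧ γ.toFun γ.b = z ∧ γ.length = edist y z

/-- The vertices of the standard equilateral Euclidean simplex of side length `r`. -/
def simplexVertex (r : ℝ) (i : Fin 3) : EuclideanSpace ℝ (Fin 3) :=
  (r / Real.sqrt 2) • EuclideanSpace.single i (1:ℝ)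

/-- The standard equilateral Euclidean `k`-simplex of side length `r` (for `k ≤ 2`). -/
def euclideanSimplex (r : ℝ) (k : Fin 3) : Set (EuclideanSpace ℝ (Fin 3)) :=
  convexHull ℝ (simplexVertex r '' {i : Fin 3 | i ≤ k})

/-- A finite metric simplicial complex of dimension at most `2`, equipped with a geodesic
metric in which every simplex is a Euclidean simplex of side length `r`. -/
structure EuclideanComplex2 (r : ℝ) where
  space : Type
  [metricSpace : MetricSpace space]
  [measurableSpace : MeasurableSpace space]
  [borelSpace : BorelSpace space]
  ι : Type
  [finite : Finite ι]
  dim : ι → Fin 3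
  face : ι → Set space
  face_isom : ∀ i, Nonempty (↥(face i) ≃ᵢ ↥(euclideanSimplex r (dim i)))
  covers : ⋃ i, face i = Set.univ
  geodesic : IsGeodesicSpace space

attribute [instance] EuclideanComplex2.metricSpace EuclideanComplex2.measurableSpace
  EuclideanComplex2.borelSpace EuclideanComplex2.finite

/-- The `1`-skeleton of such a complex. -/
def EuclideanComplex2.oneSkeleton {r : ℝ} (K : EuclideanComplex2 r) : Set K.space :=
  ⋃ i ∈ {i | K.dim i ≤ 1}, K.face i

open Metric MeasureTheory Set Filter Topology ENNReal NNReal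



/-- The metric speed `|f'|(t)` of a map `f : ℝ → X`. -/
def metricSpeed {X : Type*} [PseudoEMetricSpace X] (f : ℝ → X) (t : ℝ) : ℝ≥0∞ :=
  Filter.limsup (fun s : ℝ => edist (f s) (f t) / ENNReal.ofReal |s - t|) (𝓝[≠] t)

/-- The path integral `∫_γ ρ` of a Borel density `ρ` along a curve `γ`. -/
def MCurve.pathIntegral {X : Type*} [PseudoEMetricSpace X] (γ : MCurve X) (ρ : X → ℝ≥0∞) : ℝ≥0∞ :=
  ∫⁻ t in Set.Icc γ.a γ.b, ρ (γ.toFun t) * metricSpeed γ.toFun t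

/-- The family of curves whose image is contained in `S`. -/
def CurvesIn {X : Type*} [PseudoEMetricSpace X] (S : Set X) : Set (MCurve X) :=
  {γ | ∀ t ∈ Set.Icc γ.a γ.b, γ.toFun t ∈ S}

/-- The family `u ∘ Γ` of all compositions `u ∘ γ`, `γ ∈ Γ`. -/
def mapFamily {X Y : Type*} [PseudoEMetricSpace X] [PseudoEMetricSpace Y]
    (u : X → Y) (Γ : Set (MCurve X)) : Set (MCurve Y) :=
  {δ | ∃ γ ∈ Γ, δ.a = γ.a ∧ δ.b = γ.b ∧ δ.toFun = u ∘ γ.toFun}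

section Modulus

variable {X : Type*} [EMetricSpace X] [MeasurableSpace X] [BorelSpace X]

/-- A Borel function `ρ` is admissible for the curve family `Γ` if `∫_γ ρ ≥ 1` for every
(locally) rectifiable curve in `Γ`. -/
def Admissible (Γ : Set (MCurve X)) (ρ : X → ℝ≥0∞) : Prop :=
  Measurable ρ ∧ ∀ γ ∈ Γ, γ.length ≠ ⊤ → 1 ≤ γ.pathIntegral ρ

/-- The conformal modulus of a family of curves, with respect to Hausdorff `2`-measure. -/
def MOD (Γ : Set (MCurve X)) : ℝ≥0∞ :=
  ⨅ (ρ : X → ℝ≥0∞) (_ : Admissible Γ ρ), ∫⁻ x, ρ x ^ 2 ∂(μH[2] : Measure X)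

/-- The family of curves joining `E` and `F` within `G`. -/
def joiningCurves (E F G : Set X) : Set (MCurve X) :=
  {γ | (∀ t ∈ Set.Icc γ.a γ.b, γ.toFun t ∈ G) ∧ γ.toFun γ.a ∈ E ∧ γ.toFun γ.b ∈ F}

/-- `MOD(E, F; G)`, the modulus of the family of curves joining `E` and `F` within `G`. -/
def MODJoin (E F G : Set X) : ℝ≥0∞ := MOD (joiningCurves E F G)

end Modulus


/-- A Jordan curve: a subset homeomorphic to the unit circle. -/
def IsJordanCurve {X : Type*} [TopologicalSpace X] (Γ : Set X) : Prop :=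
  Nonempty (↥Γ ≃ₜ ↥unitCircle)

/-- A Jordan domain: a domain whose boundary is a Jordan curve. -/
def IsJordanDomain {X : Type*} [TopologicalSpace X] (Ω : Set X) : Prop :=
  IsOpen Ω ∧ IsConnected Ω ∧ IsJordanCurve (frontier Ω)

/-- A subset has finite length if it is the image of a rectifiable curve. -/
def HasFiniteLength {X : Type*} [MetricSpace X] (Γ : Set X) : Prop :=
  ∃ γ : MCurve X, γ.toFun '' Set.Icc γ.a γ.b = Γ ∧ γ.length ≠ ⊤

/-- `u` restricted to `S` is a homeomorphism onto `T`. -/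
def RestrictsToHomeo {A X : Type*} [TopologicalSpace A] [TopologicalSpace X]
    (u : A → X) (S : Set A) (T : Set X) : Prop :=
  ∃ e : ↥S ≃ₜ ↥T, ∀ z : ↥S, (e z : X) = u (z : A)

/-- Condition (⋆): points have vanishing modulus. -/
def PointsZeroModulus (X : Type*) [MetricSpace X] [MeasurableSpace X] [BorelSpace X] : Prop :=
  ∀ (x : X) (R : ℝ), 0 < R → ((Metric.ball x R)ᶜ).Nonempty →
    Filter.Tendsto
      (fun r : ℝ => MODJoin (Metric.ball x r) (Metric.ball x R)ᶜ (Metric.closedBall x R))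
      (𝓝[>] (0:ℝ)) (𝓝 0)

/-- Condition (⋆⋆): for every closed topological square `Q ⊆ X` with boundary edges
`ζ₁, ζ₂, ζ₃, ζ₄` in cyclic order, `MOD(ζ₁,ζ₃;Q) ⬝ MOD(ζ₂,ζ₄;Q) ≤ κ`. -/
def SquareCondition (X : Type*) [MetricSpace X] [MeasurableSpace X] [BorelSpace X]
    (κ : ℝ≥0∞) : Prop :=
  ∀ (φ : ℝ × ℝ → X) (Q : Set X),
    RestrictsToHomeo φ (Set.Icc (0:ℝ) 1 ×ˢ Set.Icc (0:ℝ) 1) Q →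
    MODJoin (φ '' (Set.Icc (0:ℝ) 1 ×ˢ {(0:ℝ)})) (φ '' (Set.Icc (0:ℝ) 1 ×ˢ {(1:ℝ)})) Q *
      MODJoin (φ '' ({(0:ℝ)} ×ˢ Set.Icc (0:ℝ) 1)) (φ '' ({(1:ℝ)} ×ˢ Set.Icc (0:ℝ) 1)) Q ≤ κ

section Sobolev

variable {X : Type*} [MetricSpace X]

/-- `g` is a weak upper gradient of `u` on `U`: the upper gradient inequality holds along all
rectifiable curves in `U` outside an exceptional family of modulus zero. -/
def IsWeakUpperGradientOn (u : E2 → X) (U : Set E2) (g : E2 → ℝ≥0∞) : Prop :=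
  ∃ Γ₀ : Set (MCurve E2), MOD Γ₀ = 0 ∧
    ∀ γ : MCurve E2, γ ∈ CurvesIn U → γ.length ≠ ⊤ → γ ∉ Γ₀ →
      edist (u (γ.toFun γ.a)) (u (γ.toFun γ.b)) ≤ γ.pathIntegral g

/-- Membership in the Newton–Sobolev space `N^{1,2}(U, X)`. -/
def MemN12 (U : Set E2) (u : E2 → X) : Prop :=
  AEStronglyMeasurable u (volume.restrict U) ∧
  (∃ x₀ : X, (∫⁻ z in U, edist (u z) x₀ ^ 2) ≠ ⊤) ∧
  ∃ g : E2 → ℝ≥0∞, Measurable g ∧ IsWeakUpperGradientOn u U g ∧ (∫⁻ z in U, g z ^ 2) ≠ ⊤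

/-- The Reshetnyak energy `E²₊(u)` of `u` on the unit disc: the infimum of `∫_D g²` over all
weak upper gradients `g` of `u` (attained by the minimal weak upper gradient). -/
def energy (u : E2 → X) : ℝ≥0∞ :=
  ⨅ (g : E2 → ℝ≥0∞) (_ : Measurable g ∧ IsWeakUpperGradientOn u unitDisc g),
    ∫⁻ z in unitDisc, g z ^ 2

/-- `g` is the minimal weak upper gradient of `u` on the unit disc. -/
def IsMinimalWUG (u : E2 → X) (g : E2 → ℝ≥0∞) : Prop :=
  Measurable g ∧ IsWeakUpperGradientOn u unitDisc g ∧ (∫⁻ z in unitDisc, g z ^ 2) ≠ ⊤ ∧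
    ∀ h : E2 → ℝ≥0∞, Measurable h → IsWeakUpperGradientOn u unitDisc h →
      (∫⁻ z in unitDisc, h z ^ 2) ≠ ⊤ → ∀ᵐ z ∂(volume.restrict unitDisc), g z ≤ h z

/-- `c` is a representative of the trace of `u`: for a.e. `v ∈ S¹` the radial limit of `u`
at `v` is `c v`. -/
def IsTraceRep (u c : E2 → X) : Prop :=
  ∀ᵐ v ∂((μH[1] : Measure E2).restrict unitCircle),
    Filter.Tendsto (fun t : ℝ => u (t • v)) (𝓝[<] (1:ℝ)) (𝓝 (c v))

/-- `c` (restricted to `S¹`) is a weakly monotone parametrization of the Jordan curve `Γ`: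
a uniform limit of homeomorphisms `S¹ → Γ`. -/
def IsWeaklyMonotoneParam {Y : Type*} [MetricSpace Y] (c : E2 → Y) (Γ : Set Y) : Prop :=
  ContinuousOn c unitCircle ∧ (∀ v ∈ unitCircle, c v ∈ Γ) ∧
    ∀ ε : ℝ, 0 < ε → ∃ h : ↥unitCircle ≃ₜ ↥Γ,
      ∀ v : ↥unitCircle, dist (c (v : E2)) ((h v : ↥Γ) : Y) < ε

/-- The family `Λ(Γ, X)` of Sobolev discs spanning the Jordan curve `Γ`. -/
def Lambda (Γ : Set X) : Set (E2 → X) :=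
  {u | MemN12 unitDisc u ∧ ∃ c : E2 → X, IsWeaklyMonotoneParam c Γ ∧ IsTraceRep u c}

/-- The seminorm `s` is the approximate metric derivative of `u` at `z`:
`ap lim_{y → z} (d(u y, u z) - s(y-z)) / |y-z| = 0`. -/
def HasApproxMetricDeriv (u : E2 → X) (z : E2) (s : Seminorm ℝ E2) : Prop :=
  ∀ ε : ℝ, 0 < ε →
    Filter.Tendsto
      (fun r : ℝ =>
        volume {y : E2 | y ∈ Metric.ball z r ∧
            ε * ‖y - z‖ ≤ |dist (u y) (u z) - s (y - z)|} / volume (Metric.ball z r))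
      (𝓝[>] (0:ℝ)) (𝓝 0)

end Sobolev

open Classical in
/-- The Jacobian `J(s)` of a seminorm `s` on `ℝ²`: the Hausdorff 2-measure of the unit square
in `(ℝ², s)` when `s` is a norm (which equals `π / |{s ≤ 1}|`), and `0` otherwise. -/
def seminormJacobian (s : Seminorm ℝ E2) : ℝ≥0∞ :=
  if ∃ v : E2, v ≠ 0 ∧ s v = 0 then 0
  else ENNReal.ofReal Real.pi / volume {v : E2 | s v ≤ 1}

/-- `u` is infinitesimally `K`-quasiconformal: `g_u(z)² ≤ K ⬝ J(md u_z)` for a.e. `z ∈ D`. -/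
def InfinitesimallyQC {X : Type*} [MetricSpace X] (u : E2 → X) (K : ℝ≥0∞) : Prop :=
  ∃ g : E2 → ℝ≥0∞, IsMinimalWUG u g ∧
    ∀ᵐ z ∂(volume.restrict unitDisc),
      ∃ s : Seminorm ℝ E2, HasApproxMetricDeriv u z s ∧ g z ^ 2 ≤ K * seminormJacobian s

/-- The parametrized (Hausdorff) area `Area(u) = ∫_D J(md u_z) dz`. -/
def parametrizedArea {X : Type*} [MetricSpace X] (u : E2 → X) : ℝ≥0∞ :=
  ∫⁻ z in unitDisc, ⨆ (s : Seminorm ℝ E2) (_ : HasApproxMetricDeriv u z s), seminormJacobian s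

/-- The essential oscillation of `u` in the `δ`-ball around `z` (within the unit disc). -/
def essOsc {X : Type*} [MetricSpace X] (u : E2 → X) (z : E2) (δ : ℝ) : ℝ≥0∞ :=
  ⨅ (A : Set E2)
    (_ : A ⊆ unitDisc ∩ Metric.ball z δ ∧ volume ((unitDisc ∩ Metric.ball z δ) \ A) = 0),
    EMetric.diam (u '' A)

/-- A quasisymmetric map between metric spaces. -/
def IsQuasisymmetric {M X : Type*} [MetricSpace M] [MetricSpace X] (u : M → X) : Prop :=
  ∃ η : ℝ≥0 ≃ₜ ℝ≥0, ∀ z a b : M, ∀ t : ℝ≥0,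
    dist z a ≤ (t : ℝ) * dist z b → dist (u z) (u a) ≤ (η t : ℝ) * dist (u z) (u b)

/-- A map `u` is quasisymmetric on a subset `S` of its domain. -/
def IsQuasisymmetricOn {M X : Type*} [MetricSpace M] [MetricSpace X] (u : M → X)
    (S : Set M) : Prop :=
  ∃ η : ℝ≥0 ≃ₜ ℝ≥0, ∀ z ∈ S, ∀ a ∈ S, ∀ b ∈ S, ∀ t : ℝ≥0,
    dist z a ≤ (t : ℝ) * dist z b → dist (u z) (u a) ≤ (η t : ℝ) * dist (u z) (u b)

/-- A metric space is linearly locally connected. -/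
def LinearlyLocallyConnected (X : Type*) [MetricSpace X] : Prop :=
  ∃ lam : ℝ, 1 ≤ lam ∧ ∀ (x : X) (r : ℝ), 0 < r →
    (∀ y ∈ Metric.ball x r, ∀ z ∈ Metric.ball x r, ∃ C : Set X, IsCompact C ∧ IsConnected C ∧
      y ∈ C ∧ z ∈ C ∧ C ⊆ Metric.ball x (lam * r)) ∧
    (∀ y ∉ Metric.ball x r, ∀ z ∉ Metric.ball x r, ∃ C : Set X, IsCompact C ∧ IsConnected C ∧
      y ∈ C ∧ z ∈ C ∧ C ⊆ (Metric.ball x (r / lam))ᶜ)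

/-- A subset `S` is `2`-rectifiable: up to an `H²`-null set, `S` is covered by countably many
Lipschitz images of subsets of `ℝ²`. -/
def Is2Rectifiable {X : Type*} [MetricSpace X] [MeasurableSpace X] [BorelSpace X]
    (S : Set X) : Prop :=
  ∃ (A : ℕ → Set E2) (f : ℕ → E2 → X), (∀ n, ∃ K : ℝ≥0, LipschitzOnWith K (f n) (A n)) ∧
    μH[2] (S \ ⋃ n, f n '' A n) = 0

/-- The boundary circle `∂X` of a space homeomorphic to the closed disc. -/
def discBoundary {X : Type*} [TopologicalSpace X] (φ : ↥unitClosedDisc ≃ₜ X) : Set X :=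
  {x : X | ((φ.symm x : ↥unitClosedDisc) : E2) ∈ unitCircle}

/-- `f` is biLipschitz on `S`. -/
def BiLipschitzOn {A X : Type*} [PseudoMetricSpace A] [PseudoMetricSpace X]
    (f : A → X) (S : Set A) : Prop :=
  ∃ K : ℝ≥0, 0 < K ∧ ∀ v ∈ S, ∀ w ∈ S,
    (K : ℝ)⁻¹ * dist v w ≤ dist (f v) (f w) ∧ dist (f v) (f w) ≤ (K : ℝ) * dist v w

/-- A biLipschitz curve: the image of a biLipschitz embedding of `S¹` or of an interval. -/
def IsBiLipschitzCurve {X : Type*} [MetricSpace X] (T : Set X) : Prop :=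
  (∃ f : E2 → X, BiLipschitzOn f unitCircle ∧ f '' unitCircle = T) ∨
  (∃ f : ℝ → X, BiLipschitzOn f (Set.Icc 0 1) ∧ f '' Set.Icc 0 1 = T)

/-- `T` is a Jordan arc intersecting the set `B` exactly at its two endpoints. -/
def IsJordanArcMeetingBoundaryAtEndpoints {X : Type*} [TopologicalSpace X] (T B : Set X) : Prop :=
  ∃ h : ↥(Set.Icc (0:ℝ) 1) ≃ₜ ↥T,
    T ∩ B = {((h ⟨0, Set.mem_Icc.mpr (by norm_num)⟩ : ↥T) : X),
             ((h ⟨1, Set.mem_Icc.mpr (by norm_num)⟩ : ↥T) : X)}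

/-- `c` is a continuous-representative-of-trace of `u` on the convex domain `W`, with respect to
radial approach from an interior point `p`. -/
def IsTraceRepOn {X : Type*} [MetricSpace X] (u c : E2 → X) (W : Set E2) (p : E2) : Prop :=
  ∀ᵐ w ∂((μH[1] : Measure E2).restrict (frontier W)),
    Filter.Tendsto (fun t : ℝ => u ((1 - t) • p + t • w)) (𝓝[<] (1:ℝ)) (𝓝 (c w))

/-- The induced length (inner) distance of a metric space. -/
def lengthDist {X : Type*} [MetricSpace X] (x y : X) : ℝ≥0∞ :=
  ⨅ (γ : MCurve X) (_ : γ.toFun γ.a = x ∧ γ.toFun γ.b = y), γ.length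

/-- An injective metric space: `1`-Lipschitz maps into it extend from subsets. -/
def IsInjectiveMetricSpace (E : Type*) [MetricSpace E] : Prop :=
  ∀ (Z : Type) [MetricSpace Z], ∀ (Y : Set Z) (f : ↥Y → E), LipschitzWith 1 f →
    ∃ F : Z → E, LipschitzWith 1 F ∧ ∀ y : ↥Y, F (y : Z) = f y



open unitInterval in
/-- A nowhere vanishing complex function on the square has a continuous argument. -/
theorem exists_continuous_arg (F : I × I → ℂ) (hF : Continuous F) (h0 : ∀ q, F q ≠ 0) :
    ∃ θ : I × I → ℝ, Continuous θ ∧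
      ∀ q, (F q).re = ‖F q‖ * Real.cos (θ q) ∧ (F q).im = ‖F q‖ * Real.sin (θ q) := by
  let H : C(I × I, {z : ℂ // z ≠ 0}) := ⟨fun q => ⟨F q, h0 q⟩, by fun_prop⟩
  have cov := Complex.isCoveringMap_exp
  let H0 : C(I, {z : ℂ // z ≠ 0}) := H.comp ⟨fun t => (0, t), by fun_prop⟩
  have e0 : H0 0 = (fun z : ℂ => (⟨_, z.exp_ne_zero⟩ : {z : ℂ // z ≠ 0}))
      (Complex.log (F (0, 0))) := by
    apply Subtype.ext
    simp [H0, H, Complex.exp_log (h0 (0, 0))]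
  let f : C(I, ℂ) := cov.liftPath H0 _ e0
  have hf : ∀ a, H (0, a) = (fun z : ℂ => (⟨_, z.exp_ne_zero⟩ : {z : ℂ // z ≠ 0})) (f a) :=
    fun a => (congr_fun (cov.liftPath_lifts H0 _ e0) a).symm
  let G := cov.liftHomotopy H f hf
  have hG : ∀ q, F q = Complex.exp (G q) := fun q =>
    (congr_arg Subtype.val (congr_fun (cov.liftHomotopy_lifts H f hf) q)).symm
  refine ⟨fun q => (G q).im, by fun_prop, fun q => ?_⟩
  rw [hG q, Complex.norm_exp, Complex.exp_re, Complex.exp_im]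
  exact ⟨rfl, rfl⟩

/-- If the angle stays in a closed half plane along a connected set, it cannot wrap around. -/
theorem abs_sub_le_of_cos_nonneg {α : Type*} [TopologicalSpace α] {S : Set α}
    (hS : IsPreconnected S) {θ : α → ℝ} (hθ : ContinuousOn θ S) (φ : ℝ)
    (hc : ∀ q ∈ S, 0 ≤ Real.cos (θ q - φ)) {q q' : α} (hq : q ∈ S) (hq' : q' ∈ S)
    (h : |θ q - φ| ≤ Real.pi / 2) : |θ q' - φ| ≤ Real.pi / 2 := by
  by_contra! hlt
  have hpi := Real.pi_pos
  have hcont : ContinuousOn (fun q => |θ q - φ|) S := (hθ.sub continuousOn_const).abs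
  have := hS.intermediate_value hq hq' hcont
  obtain ⟨r, hr, hrv⟩ := this (show min |θ q' - φ| Real.pi ∈ _ from
    ⟨le_min (h.trans hlt.le) (by linarith), min_le_left _ _⟩)
  have h1 : Real.cos (θ r - φ) < 0 := by
    rw [← Real.cos_abs]
    simp only at hrv
    rw [hrv]
    apply Real.cos_neg_of_pi_div_two_lt_of_lt
    · exact lt_min hlt (by linarith)
    · have := min_le_right |θ q' - φ| Real.pi
      linarith
  exact absurd (hc r hr) (not_le.2 h1)

open unitInterval in
/-- Continuous argument of the difference of two disjoint paths in the square. -/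
theorem exists_continuous_arg_sub (f g : I → I × I) (hf : Continuous f) (hg : Continuous g)
    (hfg : ∀ s t, f s ≠ g t) :
    ∃ (θ : I × I → ℝ) (ρ : I × I → ℝ), Continuous θ ∧ (∀ q, 0 < ρ q) ∧ ∀ s t,
      ((f s).1 : ℝ) - (g t).1 = ρ (s, t) * Real.cos (θ (s, t)) ∧
      ((f s).2 : ℝ) - (g t).2 = ρ (s, t) * Real.sin (θ (s, t)) := by
  let F : I × I → ℂ := fun q => Complex.mk
    (((f q.1).1 : ℝ) - (g q.2).1) (((f q.1).2 : ℝ) - (g q.2).2)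
  have hF : Continuous F := by
    have : F = fun q => (((((f q.1).1 : ℝ) - (g q.2).1 : ℝ)) : ℂ) +
      ((((f q.1).2 : ℝ) - (g q.2).2 : ℝ) : ℂ) * Complex.I := by
      funext q
      apply Complex.ext <;> simp [F]
    rw [this]
    fun_prop
  have h0 : ∀ q, F q ≠ 0 := by
    intro q hq
    apply hfg q.1 q.2
    rw [Complex.ext_iff] at hq
    simp only [F, Complex.zero_re, Complex.zero_im] at hq
    ext
    · linarith [hq.1]
    · linarith [hq.2]
  obtain ⟨θ, hθ, h⟩ := exists_continuous_arg F hF h0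
  exact ⟨θ, fun q => ‖F q‖, hθ, fun q => norm_pos_iff.2 (h0 q), fun s t => h (s, t)⟩

/-- Shifting an angle by a multiple of `2π`. -/
theorem exists_int_abs_le (x φ : ℝ) (h : 0 ≤ Real.cos (x - φ)) :
    ∃ k : ℤ, |x + k * (2 * Real.pi) - φ| ≤ Real.pi / 2 := by
  have hpi := Real.pi_pos
  obtain ⟨y, hy, k, hk⟩ : ∃ y : ℝ, |y| ≤ Real.pi ∧ ∃ k : ℤ, x - φ + k * (2 * Real.pi) = y := by
    refine ⟨toIocMod Real.two_pi_pos (-Real.pi) (x - φ), ?_,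
      -toIocDiv Real.two_pi_pos (-Real.pi) (x - φ), ?_⟩
    · have := toIocMod_mem_Ioc Real.two_pi_pos (-Real.pi) (x - φ)
      rw [abs_le]
      constructor <;> linarith [this.1, this.2]
    · simp only [toIocMod, zsmul_eq_mul]
      push_cast
      ring
  refine ⟨k, ?_⟩
  have e : x + k * (2 * Real.pi) - φ = y := by linarith
  rw [e]
  by_contra! hlt
  have hc : Real.cos (x - φ) = Real.cos y := by rw [← hk, Real.cos_add_int_mul_two_pi]
  rw [hc, ← Real.cos_abs] at h
  exact absurd h (not_le.2 (Real.cos_neg_of_pi_div_two_lt_of_lt hlt (by linarith)))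

theorem abs_sub_le_of_abs_sub_lt {x φ : ℝ} (h : |x - φ| < 3 * Real.pi / 2)
    (hc : 0 ≤ Real.cos (x - φ)) : |x - φ| ≤ Real.pi / 2 := by
  by_contra! hlt
  rw [← Real.cos_abs] at hc
  exact absurd hc (not_le.2 (Real.cos_neg_of_pi_div_two_lt_of_lt hlt (by linarith)))

theorem abs_sub_le_of_abs_sub_le {x φ ψ : ℝ} (h : |x - φ| ≤ Real.pi / 2)
    (hψ : |φ - ψ| ≤ Real.pi / 2)
    (hc : 0 ≤ Real.cos (x - ψ)) : |x - ψ| ≤ Real.pi / 2 := by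
  refine abs_sub_le_of_abs_sub_lt ?_ hc
  have := abs_sub_le x φ ψ
  linarith [Real.pi_pos]

section Crossing

open unitInterval

variable {θ : I × I → ℝ}

theorem edge_fst (hθ : Continuous θ) (s : I) (φ : ℝ)
    (hc : ∀ t, 0 ≤ Real.cos (θ (s, t) - φ)) (t t' : I)
    (h : |θ (s, t) - φ| ≤ Real.pi / 2) : |θ (s, t') - φ| ≤ Real.pi / 2 :=
  abs_sub_le_of_cos_nonneg (S := univ) isPreconnected_univ (θ := fun t => θ (s, t))
    (Continuous.continuousOn (by fun_prop)) φ (fun q _ => hc q) (mem_univ t) (mem_univ t') h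

theorem edge_snd (hθ : Continuous θ) (t : I) (φ : ℝ)
    (hc : ∀ s, 0 ≤ Real.cos (θ (s, t) - φ)) (s s' : I)
    (h : |θ (s, t) - φ| ≤ Real.pi / 2) : |θ (s', t) - φ| ≤ Real.pi / 2 :=
  abs_sub_le_of_cos_nonneg (S := univ) isPreconnected_univ (θ := fun s => θ (s, t))
    (Continuous.continuousOn (by fun_prop)) φ (fun q _ => hc q) (mem_univ s) (mem_univ s') h

theorem cos_sub_three_pi_div_two (x : ℝ) : Real.cos (x - 3 * Real.pi / 2) = -Real.sin x := by
  rw [show x - 3 * Real.pi / 2 = (x - Real.pi) - Real.pi / 2 by ring, Real.cos_sub_pi_div_two,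
    Real.sin_sub_pi]

theorem cos_add_pi_div_two' (x : ℝ) : Real.cos (x - -(Real.pi / 2)) = -Real.sin x := by
  rw [sub_neg_eq_add, Real.cos_add_pi_div_two]

theorem cos_add_pi' (x : ℝ) : Real.cos (x - -Real.pi) = -Real.cos x := by
  rw [sub_neg_eq_add, Real.cos_add_pi]

/-- Two curves joining opposite sides of the square intersect. -/
theorem crossing {F G : Set (I × I)} (hFG : Disjoint F G) {x y z w : I × I}
    (hF : JoinedIn F x y) (hx : x.1 = 0) (hy : y.1 = 1)
    (hG : JoinedIn G z w) (hz : z.2 = 0) (hw : w.2 = 1) : False := by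
  obtain ⟨f, hf⟩ := hF
  obtain ⟨g, hg⟩ := hG
  obtain ⟨θ₀, ρ, hθ₀, hρ, h₀⟩ := exists_continuous_arg_sub f g f.continuous g.continuous
    (fun s t e => disjoint_left.1 hFG (hf s) (e ▸ hg t))
  have hpi := Real.pi_pos
  have a1 : ∀ t, Real.cos (θ₀ (0, t)) ≤ 0 := fun t => by
    have := (h₀ 0 t).1
    rw [f.source, hx] at this
    have h2 := (g t).1.2.1
    have h3 := hρ (0, t)
    simp only [Icc.coe_zero] at this
    by_contra! hh
    nlinarith [mul_pos h3 hh]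
  have a2 : ∀ t, 0 ≤ Real.cos (θ₀ (1, t)) := fun t => by
    have := (h₀ 1 t).1
    rw [f.target, hy] at this
    have h2 := (g t).1.2.2
    have h3 := hρ (1, t)
    simp only [Icc.coe_one] at this
    by_contra! hh
    nlinarith [mul_neg_of_pos_of_neg h3 hh]
  have a3 : ∀ s, 0 ≤ Real.sin (θ₀ (s, 0)) := fun s => by
    have := (h₀ s 0).2
    rw [g.source, hz] at this
    have h2 := (f s).2.2.1
    have h3 := hρ (s, 0)
    simp only [Icc.coe_zero] at this
    by_contra! hh
    nlinarith [mul_neg_of_pos_of_neg h3 hh]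
  have a4 : ∀ s, Real.sin (θ₀ (s, 1)) ≤ 0 := fun s => by
    have := (h₀ s 1).2
    rw [g.target, hw] at this
    have h2 := (f s).2.2.2
    have h3 := hρ (s, 1)
    simp only [Icc.coe_one] at this
    by_contra! hh
    nlinarith [mul_pos h3 hh]
  obtain ⟨k, hk⟩ := exists_int_abs_le (θ₀ (0, 0)) Real.pi (by
    rw [Real.cos_sub_pi]; linarith [a1 0])
  set θ : I × I → ℝ := fun q => θ₀ q + k * (2 * Real.pi) with hθd
  have hθ : Continuous θ := by fun_prop
  have hcos : ∀ q, Real.cos (θ q) = Real.cos (θ₀ q) := fun q => Real.cos_add_int_mul_two_pi _ _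
  have hsin : ∀ q, Real.sin (θ q) = Real.sin (θ₀ q) := fun q => Real.sin_add_int_mul_two_pi _ _
  have c1 : ∀ t, 0 ≤ Real.cos (θ (0, t) - -Real.pi) := fun t => by
    rw [cos_add_pi', hcos]; linarith [a1 t]
  have c2 : ∀ t, 0 ≤ Real.cos (θ (1, t) - 0) := fun t => by rw [sub_zero, hcos]; exact a2 t
  have c3 : ∀ s, 0 ≤ Real.cos (θ (s, 0) - Real.pi / 2) := fun s => by
    rw [Real.cos_sub_pi_div_two, hsin]; exact a3 s
  have c4 : ∀ s, 0 ≤ Real.cos (θ (s, 1) - -(Real.pi / 2)) := fun s => by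
    rw [cos_add_pi_div_two', hsin]; linarith [a4 s]
  have e1 := abs_sub_le_of_abs_sub_le (x := θ (0, 0)) hk
    (show |Real.pi - Real.pi / 2| ≤ _ by rw [abs_of_pos] <;> linarith) (c3 0)
  have e2 := abs_sub_le_of_abs_sub_le (edge_snd hθ 0 _ c3 0 1 e1)
    (show |Real.pi / 2 - 0| ≤ _ by rw [abs_of_pos] <;> linarith) (c2 0)
  have e3 := abs_sub_le_of_abs_sub_le (edge_fst hθ 1 _ c2 0 1 e2)
    (show |0 - -(Real.pi / 2)| ≤ _ by rw [abs_of_pos] <;> linarith) (c4 1)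
  have e4 := abs_sub_le_of_abs_sub_le (edge_snd hθ 1 _ c4 1 0 e3)
    (show |-(Real.pi / 2) - -Real.pi| ≤ _ by rw [abs_of_pos] <;> linarith) (c1 1)
  have e5 := edge_fst hθ 0 _ c1 1 0 e4
  have hk' : |θ (0, 0) - Real.pi| ≤ Real.pi / 2 := hk
  rw [abs_le] at e5 hk'
  linarith [e5.2, hk'.1]

/-- A curve starting on the bottom side to the left of another curve which reaches the left side
cannot reach the top or the right side without hitting it. -/
theorem separation {F G : Set (I × I)} (hFG : Disjoint F G) {x y z w : I × I}
    (hF : JoinedIn F x y) (hx : x.2 = 0) (hy : y.2 = 1 ∨ y.1 = 1)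
    (hG : JoinedIn G z w) (hz : z.2 = 0) (hw : w.1 = 0) (hxz : x.1 < z.1) : False := by
  obtain ⟨f, hf⟩ := hF
  obtain ⟨g, hg⟩ := hG
  obtain ⟨θ₀, ρ, hθ₀, hρ, h₀⟩ := exists_continuous_arg_sub f g f.continuous g.continuous
    (fun s t e => disjoint_left.1 hFG (hf s) (e ▸ hg t))
  have hpi := Real.pi_pos
  have a0 : Real.cos (θ₀ (0, 0)) ≤ 0 := by
    have := (h₀ 0 0).1
    rw [f.source, g.source] at this
    have h3 := hρ (0, 0)
    have h4 : (x.1 : ℝ) < z.1 := hxz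
    by_contra! hh
    nlinarith [mul_pos h3 hh]
  have a1 : ∀ t, Real.sin (θ₀ (0, t)) ≤ 0 := fun t => by
    have := (h₀ 0 t).2
    rw [f.source, hx] at this
    have h2 := (g t).2.2.1
    have h3 := hρ (0, t)
    simp only [Icc.coe_zero] at this
    by_contra! hh
    nlinarith [mul_pos h3 hh]
  have a3 : ∀ s, 0 ≤ Real.sin (θ₀ (s, 0)) := fun s => by
    have := (h₀ s 0).2
    rw [g.source, hz] at this
    have h2 := (f s).2.2.1
    have h3 := hρ (s, 0)
    simp only [Icc.coe_zero] at this
    by_contra! hh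
    nlinarith [mul_neg_of_pos_of_neg h3 hh]
  have a4 : ∀ s, 0 ≤ Real.cos (θ₀ (s, 1)) := fun s => by
    have := (h₀ s 1).1
    rw [g.target, hw] at this
    have h2 := (f s).1.2.1
    have h3 := hρ (s, 1)
    simp only [Icc.coe_zero] at this
    by_contra! hh
    nlinarith [mul_neg_of_pos_of_neg h3 hh]
  obtain ⟨k, hk⟩ := exists_int_abs_le (θ₀ (0, 0)) Real.pi (by
    rw [Real.cos_sub_pi]; linarith)
  set θ : I × I → ℝ := fun q => θ₀ q + k * (2 * Real.pi) with hθd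
  have hθ : Continuous θ := by fun_prop
  have hcos : ∀ q, Real.cos (θ q) = Real.cos (θ₀ q) := fun q => Real.cos_add_int_mul_two_pi _ _
  have hsin : ∀ q, Real.sin (θ q) = Real.sin (θ₀ q) := fun q => Real.sin_add_int_mul_two_pi _ _
  have c1 : ∀ t, 0 ≤ Real.cos (θ (0, t) - 3 * Real.pi / 2) := fun t => by
    rw [cos_sub_three_pi_div_two, hsin]; linarith [a1 t]
  have c3 : ∀ s, 0 ≤ Real.cos (θ (s, 0) - Real.pi / 2) := fun s => by
    rw [Real.cos_sub_pi_div_two, hsin]; exact a3 s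
  have c4 : ∀ s, 0 ≤ Real.cos (θ (s, 1) - 2 * Real.pi) := fun s => by
    rw [Real.cos_sub_two_pi, hcos]; exact a4 s
  have hk' : |θ (0, 0) - Real.pi| ≤ Real.pi / 2 := hk
  have e1 := abs_sub_le_of_abs_sub_le hk'
    (show |Real.pi - Real.pi / 2| ≤ _ by rw [abs_of_pos] <;> linarith) (c3 0)
  have e1' := abs_sub_le_of_abs_sub_le hk'
    (show |Real.pi - 3 * Real.pi / 2| ≤ _ by rw [abs_of_neg] <;> linarith) (c1 0)
  have e2 := edge_snd hθ 0 _ c3 0 1 e1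
  have e3 := abs_sub_le_of_abs_sub_le (edge_fst hθ 0 _ c1 0 1 e1')
    (show |3 * Real.pi / 2 - 2 * Real.pi| ≤ _ by rw [abs_of_neg] <;> linarith) (c4 0)
  have e4 := edge_snd hθ 1 _ c4 0 1 e3
  rw [abs_le] at e4
  rcases hy with hy | hy
  · have a5 : ∀ t, 0 ≤ Real.sin (θ₀ (1, t)) := fun t => by
      have := (h₀ 1 t).2
      rw [f.target, hy] at this
      have h2 := (g t).2.2.2
      have h3 := hρ (1, t)
      simp only [Icc.coe_one] at this
      by_contra! hh
      nlinarith [mul_neg_of_pos_of_neg h3 hh]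
    have e5 := edge_fst hθ 1 (Real.pi / 2) (fun t => by
      rw [Real.cos_sub_pi_div_two, hsin]; exact a5 t) 0 1 e2
    rw [abs_le] at e5
    linarith [e5.2, e4.1]
  · have a5 : ∀ t, 0 ≤ Real.cos (θ₀ (1, t)) := fun t => by
      have := (h₀ 1 t).1
      rw [f.target, hy] at this
      have h2 := (g t).1.2.2
      have h3 := hρ (1, t)
      simp only [Icc.coe_one] at this
      by_contra! hh
      nlinarith [mul_neg_of_pos_of_neg h3 hh]
    have c5 : ∀ t, 0 ≤ Real.cos (θ (1, t) - 0) := fun t => by rw [sub_zero, hcos]; exact a5 t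
    have e5 := edge_fst hθ 1 0 c5 0 1 (abs_sub_le_of_abs_sub_le e2
      (show |Real.pi / 2 - 0| ≤ _ by rw [abs_of_pos] <;> linarith) (c5 0))
    rw [abs_le] at e5
    linarith [e5.2, e4.1]

end Crossing

section Unicoherence

open unitInterval

theorem eq_of_cos_eq_of_sin_eq {α : Type*} [TopologicalSpace α] {S : Set α}
    (hS : IsPreconnected S) {θ η : α → ℝ} (hθ : ContinuousOn θ S) (hη : ContinuousOn η S)
    (hc : ∀ q ∈ S, Real.cos (θ q) = Real.cos (η q))
    (hs : ∀ q ∈ S, Real.sin (θ q) = Real.sin (η q)) {c d : α} (hc' : c ∈ S) (hd : d ∈ S) :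
    θ c - η c = θ d - η d := by
  have h1 : ∀ q ∈ S, Real.cos (θ q - η q) = 1 ∧ Real.sin (θ q - η q) = 0 := fun q hq => by
    rw [Real.cos_sub, Real.sin_sub, hc q hq, hs q hq]
    constructor
    · nlinarith [Real.cos_sq_add_sin_sq (η q)]
    · ring
  have h2 : ∀ q ∈ S, Real.cos ((θ q - η q) - (θ c - η c)) = 1 := fun q hq => by
    rw [Real.cos_sub, (h1 q hq).1, (h1 c hc').1, (h1 c hc').2]
    ring
  have h3 := abs_sub_le_of_cos_nonneg hS (hθ.sub hη) (θ c - η c)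
    (fun q hq => by simp only [Pi.sub_apply]; rw [h2 q hq]; exact zero_le_one) hc' hd
    (by simpa using (half_pos Real.pi_pos).le)
  simp only [Pi.sub_apply] at h3
  rw [abs_le] at h3
  have := (Real.cos_eq_one_iff_of_lt_of_lt (by linarith [Real.pi_pos])
    (by linarith [Real.pi_pos])).1
    (h2 d hd)
  linarith

/-- The square is unicoherent. -/
theorem isPreconnected_inter_of_isClosed {A B : Set (I × I)} (hA : IsClosed A) (hB : IsClosed B)
    (hAc : IsPreconnected A) (hBc : IsPreconnected B) (hAB : A ∪ B = univ) :
    IsPreconnected (A ∩ B) := by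
  rw [isPreconnected_closed_iff]
  intro t t' ht ht' hsub ⟨c, hc, hct⟩ ⟨d, hd, hdt⟩
  by_contra hne
  rw [not_nonempty_iff_eq_empty] at hne
  obtain ⟨f, hf0, hf1, -⟩ := exists_continuous_zero_one_of_isClosed (s := A ∩ B ∩ t)
    (t := A ∩ B ∩ t') ((hA.inter hB).inter ht) ((hA.inter hB).inter ht')
    (by
      rw [Set.disjoint_left]
      intro x hx hx'
      have : x ∈ A ∩ B ∩ (t ∩ t') := ⟨hx.1, hx.2, hx'.2⟩
      rw [hne] at this
      exact this)
  classical
  let F : I × I → ℂ := fun q => if q ∈ A then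
    (Real.cos (Real.pi * f q) : ℂ) + (Real.sin (Real.pi * f q) : ℂ) * Complex.I
    else (Real.cos (Real.pi * f q) : ℂ) + (Real.sin (-(Real.pi * f q)) : ℂ) * Complex.I
  have hFA : ∀ q ∈ A, F q =
      (Real.cos (Real.pi * f q) : ℂ) + (Real.sin (Real.pi * f q) : ℂ) * Complex.I :=
    fun q hq => if_pos hq
  have hFB : ∀ q ∈ B, F q =
      (Real.cos (Real.pi * f q) : ℂ) + (Real.sin (-(Real.pi * f q)) : ℂ) * Complex.I := by
    intro q hq
    by_cases hqA : q ∈ A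
    · rw [hFA q hqA]
      rcases hsub ⟨hqA, hq⟩ with h | h
      · have := hf0 ⟨⟨hqA, hq⟩, h⟩
        simp only [Pi.zero_apply] at this
        rw [this]; simp
      · have := hf1 ⟨⟨hqA, hq⟩, h⟩
        simp only [Pi.one_apply] at this
        rw [this]; simp
    · exact if_neg hqA
  have hF : Continuous F := by
    rw [← continuousOn_univ, ← hAB]
    refine ContinuousOn.union_of_isClosed ?_ ?_ hA hB
    · refine ContinuousOn.congr (Continuous.continuousOn ?_) hFA
      fun_prop
    · refine ContinuousOn.congr (Continuous.continuousOn ?_) hFB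
      fun_prop
  have hnorm : ∀ q, ‖F q‖ = 1 := by
    intro q
    rw [← sq_eq_sq₀ (norm_nonneg _) zero_le_one, ← Complex.normSq_eq_norm_sq]
    by_cases hqA : q ∈ A
    · rw [hFA q hqA, Complex.normSq_add_mul_I]; simp
    · rw [show F q = _ from if_neg hqA, Complex.normSq_add_mul_I]; simp
  obtain ⟨θ, hθ, h⟩ := exists_continuous_arg F hF (fun q hq => by
    have := hnorm q
    rw [hq] at this
    simp at this)
  simp only [hnorm, one_mul] at h
  have e1 := eq_of_cos_eq_of_sin_eq hAc hθ.continuousOn (η := fun q => Real.pi * f q)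
    (Continuous.continuousOn (by fun_prop))
    (fun q hq => by rw [← (h q).1, hFA q hq]; simp [-Complex.ofReal_cos,
      -Complex.ofReal_sin])
    (fun q hq => by rw [← (h q).2, hFA q hq]; simp [-Complex.ofReal_cos,
      -Complex.ofReal_sin]) hc.1 hd.1
  have e2 := eq_of_cos_eq_of_sin_eq hBc hθ.continuousOn (η := fun q => -(Real.pi * f q))
    (Continuous.continuousOn (by fun_prop))
    (fun q hq => by rw [← (h q).1, hFB q hq, Real.cos_neg]; simp [-Complex.ofReal_cos,
      -Complex.ofReal_sin])
    (fun q hq => by rw [← (h q).2, hFB q hq]; simp [-Complex.ofReal_cos,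
      -Complex.ofReal_sin]) hc.2 hd.2
  have f0 := hf0 ⟨hc, hct⟩
  have f1 := hf1 ⟨hd, hdt⟩
  simp only [Pi.zero_apply, Pi.one_apply] at f0 f1
  simp only [f0, f1] at e1 e2
  linarith [Real.pi_pos]

theorem frontier_connectedComponentIn_compl_subset {X : Type*} [TopologicalSpace X]
    [LocallyConnectedSpace X] {K : Set X} (hK : IsClosed K) {x z : X}
    (hz : z ∈ closure (connectedComponentIn Kᶜ x)) (hz' : z ∉ connectedComponentIn Kᶜ x) :
    z ∈ K := by
  by_contra hzK
  have ho := hK.isOpen_compl.connectedComponentIn (x := z)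
  obtain ⟨w, hw, hwx⟩ := mem_closure_iff.1 hz _ ho (mem_connectedComponentIn hzK)
  rw [connectedComponentIn_eq hwx, ← connectedComponentIn_eq hw] at hz'
  exact hz' (mem_connectedComponentIn hzK)

/-- In a connected, locally connected space the complement of a component of the complement of a
closed connected set is connected. -/
theorem isPreconnected_compl_connectedComponentIn {X : Type*} [TopologicalSpace X]
    [PreconnectedSpace X] [LocallyConnectedSpace X] {K : Set X} (hK : IsClosed K)
    (hKc : IsPreconnected K) (x : X) (hx : x ∉ K) :
    IsPreconnected (connectedComponentIn Kᶜ x)ᶜ := by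
  set C := connectedComponentIn Kᶜ x with hC
  have hCo : IsOpen C := hK.isOpen_compl.connectedComponentIn
  have hxC : x ∈ C := mem_connectedComponentIn hx
  have hKC : K ⊆ Cᶜ := fun y hy hyC => connectedComponentIn_subset _ _ hyC hy
  have key : ∀ t t' : Set X, IsClosed t → IsClosed t' → Cᶜ ⊆ t ∪ t' → (Cᶜ ∩ t').Nonempty →
      Cᶜ ∩ (t ∩ t') = ∅ → K ⊆ t → False := by
    intro t t' ht ht' hsub ⟨b, hbC, hbt⟩ hemp hKt
    have hbK : b ∈ Kᶜ := fun hb => by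
      have : b ∈ Cᶜ ∩ (t ∩ t') := ⟨hbC, hKt hb, hbt⟩
      rw [hemp] at this
      exact this
    set D := connectedComponentIn Kᶜ b with hD
    have hDo : IsOpen D := hK.isOpen_compl.connectedComponentIn
    have hbD : b ∈ D := mem_connectedComponentIn hbK
    have hDC : D ⊆ Cᶜ := fun w hw hwC => by
      apply hbC
      rw [hC, connectedComponentIn_eq hwC, ← connectedComponentIn_eq hw]
      exact hbD
    have hDt : D ⊆ t' := by
      rcases isPreconnected_closed_iff.1 (isPreconnected_connectedComponentIn (F := Kᶜ) (x := b))
        with h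
      by_contra hnot
      obtain ⟨w, hw, hwt⟩ := not_subset.1 hnot
      have hwt' : w ∈ t := (hsub (hDC hw)).resolve_right hwt
      obtain ⟨y, hy, hyt⟩ := h t t' ht ht' (hDC.trans hsub) ⟨w, hw, hwt'⟩ ⟨b, hbD, hbt⟩
      have : y ∈ Cᶜ ∩ (t ∩ t') := ⟨hDC hy, hyt⟩
      rw [hemp] at this
      exact this
    have hcl : IsClosed D := by
      rw [← closure_subset_iff_isClosed]
      intro z hz
      by_contra hzD
      have hzK := frontier_connectedComponentIn_compl_subset hK hz hzD
      have : z ∈ Cᶜ ∩ (t ∩ t') :=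
        ⟨hKC hzK, hKt hzK, closure_minimal hDt ht' hz⟩
      rw [hemp] at this
      exact this
    have := IsClopen.eq_univ ⟨hcl, hDo⟩ ⟨b, hbD⟩
    exact hDC (this ▸ mem_univ x) hxC
  rw [isPreconnected_closed_iff]
  intro t t' ht ht' hsub hn hn'
  by_contra hne
  rw [not_nonempty_iff_eq_empty] at hne
  by_cases h : K ⊆ t
  · exact key t t' ht ht' hsub hn' hne h
  · refine key t' t ht' ht (by rwa [union_comm]) hn (by rwa [inter_comm t' t]) ?_
    by_contra h'
    obtain ⟨y, hy, hyt⟩ := not_subset.1 h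
    obtain ⟨y', hy', hyt'⟩ := not_subset.1 h'
    obtain ⟨w, hw, hwt⟩ := isPreconnected_closed_iff.1 hKc t t' ht ht' (hKC.trans hsub)
      ⟨y', hy', (hsub (hKC hy')).resolve_right hyt'⟩ ⟨y, hy, (hsub (hKC hy)).resolve_left hyt⟩
    have : w ∈ Cᶜ ∩ (t ∩ t') := ⟨hKC hw, hwt⟩
    rw [hne] at this
    exact this

end Unicoherence

section LevelSets

open unitInterval

instance : LocallyConnectedSpace (I × I) := by
  have : LocallyPathConnectedSpace I := (convex_Icc (0 : ℝ) 1).locallyPathConnectedSpace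
  infer_instance

/-- The component of the sublevel set `{u ≤ a}` containing the origin. -/
def lowSet (u : I × I → ℝ) (a : ℝ) : Set (I × I) := connectedComponentIn {q | u q ≤ a} (0, 0)

/-- The component of the complement of `lowSet u a` containing the lower right corner. -/
def highSet (u : I × I → ℝ) (a : ℝ) : Set (I × I) := connectedComponentIn (lowSet u a)ᶜ (1, 0)

theorem le_of_mem_lowSet {u : I × I → ℝ} {a : ℝ} {q : I × I} (h : q ∈ lowSet u a) : u q ≤ a :=
  connectedComponentIn_subset {q | u q ≤ a} _ h

theorem isClosed_lowSet {u : I × I → ℝ} (hu : Continuous u) (a : ℝ) : IsClosed (lowSet u a) := by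
  have h : IsClosed {q | u q ≤ a} := isClosed_le hu continuous_const
  rw [← closure_subset_iff_isClosed]
  by_cases h0 : ((0, 0) : I × I) ∈ {q | u q ≤ a}
  · exact isPreconnected_connectedComponentIn.closure.subset_connectedComponentIn
      (subset_closure (mem_connectedComponentIn h0))
      (closure_minimal (connectedComponentIn_subset _ _) h)
  · rw [lowSet, connectedComponentIn_eq_empty h0, closure_empty]

theorem isPreconnected_lowSet (u : I × I → ℝ) (a : ℝ) : IsPreconnected (lowSet u a) :=
  isPreconnected_connectedComponentIn

theorem isPreconnected_vertical (x : I) : IsPreconnected (range fun y : I => (x, y)) :=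
  isPreconnected_range (by fun_prop)

theorem left_subset_lowSet {u : I × I → ℝ} {a : ℝ} (hL : ∀ y, u (0, y) ≤ a) (y : I) :
    (0, y) ∈ lowSet u a :=
  (isPreconnected_vertical 0).subset_connectedComponentIn ⟨0, rfl⟩
    (by rintro _ ⟨y, rfl⟩; exact hL y) ⟨y, rfl⟩

theorem right_subset_highSet {u : I × I → ℝ} {a : ℝ} (hR : ∀ y, a < u (1, y)) (y : I) :
    (1, y) ∈ highSet u a :=
  (isPreconnected_vertical 1).subset_connectedComponentIn ⟨0, rfl⟩
    (by
      rintro _ ⟨y, rfl⟩ h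
      exact absurd (le_of_mem_lowSet h) (not_le.2 (hR y)))
    ⟨y, rfl⟩

theorem isOpen_highSet {u : I × I → ℝ} (hu : Continuous u) (a : ℝ) : IsOpen (highSet u a) :=
  (isClosed_lowSet hu a).isOpen_compl.connectedComponentIn

theorem highSet_anti (u : I × I → ℝ) {a a' : ℝ} (h : a ≤ a') : highSet u a' ⊆ highSet u a :=
  connectedComponentIn_mono _ (compl_subset_compl.2
    (connectedComponentIn_mono _ fun _ hq => le_trans hq h))

theorem eq_of_mem_frontier_highSet {u : I × I → ℝ} (hu : Continuous u) {a : ℝ} {z : I × I}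
    (hz : z ∈ closure (highSet u a)) (hz' : z ∉ highSet u a) : u z = a := by
  have hzK : z ∈ lowSet u a :=
    frontier_connectedComponentIn_compl_subset (isClosed_lowSet hu a) hz hz'
  refine le_antisymm (le_of_mem_lowSet hzK) ?_
  by_contra! hlt
  have ho : IsOpen (connectedComponentIn {q | u q < a} z) :=
    (isOpen_lt hu continuous_const).connectedComponentIn
  have hsub : connectedComponentIn {q | u q < a} z ⊆ lowSet u a := by
    rw [lowSet, connectedComponentIn_eq hzK]
    exact connectedComponentIn_mono _ fun q (hq : u q < a) => hq.le
  obtain ⟨w, hw, hwN⟩ := mem_closure_iff.1 hz _ ho (mem_connectedComponentIn hlt)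
  exact connectedComponentIn_subset _ _ hwN (hsub hw)

theorem isPreconnected_frontier_highSet {u : I × I → ℝ} (hu : Continuous u) {a : ℝ}
    (hR : a < u (1, 0)) : IsPreconnected (closure (highSet u a) ∩ (highSet u a)ᶜ) := by
  refine isPreconnected_inter_of_isClosed isClosed_closure (isOpen_highSet hu a).isClosed_compl
    isPreconnected_connectedComponentIn.closure
    (isPreconnected_compl_connectedComponentIn (isClosed_lowSet hu a)
      (isPreconnected_lowSet u a) _ fun h =>
        absurd (le_of_mem_lowSet h) (not_le.2 hR)) ?_
  rw [eq_univ_iff_forall]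
  intro x
  by_cases hx : x ∈ highSet u a
  · exact Or.inl (subset_closure hx)
  · exact Or.inr hx

theorem exists_last_not_mem {N : Set (I × I)} (hN : IsOpen N) (y : I) (h0 : (0, y) ∉ N)
    (h1 : (1, y) ∈ N) : ∃ p : I, IsGreatest {x : I | (x, y) ∉ N} p ∧ (p, y) ∈ closure N ∩ Nᶜ := by
  have hcl : IsClosed {x : I | (x, y) ∉ N} :=
    hN.isClosed_compl.preimage (f := fun x : I => (x, y)) (by fun_prop)
  obtain ⟨p, hp⟩ := hcl.isCompact.exists_isGreatest ⟨0, h0⟩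
  have hp1 : p < 1 := lt_of_le_of_ne p.2.2 (by
    rintro rfl
    exact hp.1 h1)
  refine ⟨p, hp, ?_, hp.1⟩
  have hpc : p ∈ closure (Ioi p) := by
    have : (𝓝[>] p).NeBot := nhdsGT_neBot_of_exists_gt ⟨1, hp1⟩
    exact mem_closure_iff_nhdsWithin_neBot.2 inferInstance
  have hc : Continuous fun x : I => (x, y) := by fun_prop
  exact closure_mono (by
    rintro _ ⟨x, hx, rfl⟩
    by_contra hxN
    exact absurd (hp.2 hxN) (not_le.2 hx)) (image_closure_subset_closure_image hc ⟨p, hpc, rfl⟩)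

/-- Connected subsets of the level sets of `u` joining the bottom to the top side of the square,
with monotone dependence of the first end point. -/
theorem exists_level_continua {u : I × I → ℝ} (hu : Continuous u) {ε : ℝ}
    (hL : ∀ y, u (0, y) = 0) (hR : ∀ y, ε < u (1, y)) :
    ∃ (Z : ℝ → Set (I × I)) (p q : ℝ → I), StrictMonoOn p (Ioo 0 ε) ∧
      ∀ a ∈ Ioo 0 ε, IsCompact (Z a) ∧ IsPreconnected (Z a) ∧ (∀ z ∈ Z a, u z = a) ∧
        (p a, 0) ∈ Z a ∧ (q a, 1) ∈ Z a := by
  have hex : ∀ y : I, ∀ a : ℝ, ∃ p : I, a ∈ Ioo 0 ε →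
      IsGreatest {x : I | (x, y) ∉ highSet u a} p ∧
      (p, y) ∈ closure (highSet u a) ∩ (highSet u a)ᶜ := by
    intro y a
    by_cases ha : a ∈ Ioo 0 ε
    · obtain ⟨p, hp⟩ := exists_last_not_mem (isOpen_highSet hu a) y
        (fun h => connectedComponentIn_subset _ _ h
          (left_subset_lowSet (fun y => (hL y).trans_le ha.1.le) y))
        (right_subset_highSet (fun y => ha.2.trans (hR y)) y)
      exact ⟨p, fun _ => hp⟩
    · exact ⟨0, fun h => absurd h ha⟩
  choose p hp using hex 0
  choose q hq using hex 1
  refine ⟨fun a => closure (highSet u a) ∩ (highSet u a)ᶜ, p, q, ?_, fun a ha => ⟨?_, ?_, ?_,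
    (hp a ha).2, (hq a ha).2⟩⟩
  · intro a ha a' ha' haa'
    refine lt_of_le_of_ne ((hp a' ha').1.2 fun h => (hp a ha).1.1 (highSet_anti u haa'.le h)) ?_
    intro h
    have h1 := eq_of_mem_frontier_highSet hu (hp a ha).2.1 (hp a ha).2.2
    have h2 := eq_of_mem_frontier_highSet hu (hp a' ha').2.1 (hp a' ha').2.2
    rw [← h, h1] at h2
    exact haa'.ne h2
  · exact (isClosed_closure.inter (isOpen_highSet hu a).isClosed_compl).isCompact
  · exact isPreconnected_frontier_highSet hu (ha.2.trans (hR 0))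
  · exact fun z hz => eq_of_mem_frontier_highSet hu hz.1 hz.2

end LevelSets

section HausdorffCovers

variable {X : Type*} [MetricSpace X] [MeasurableSpace X] [BorelSpace X]

theorem exists_cover_of_hausdorffMeasure_lt {d : ℝ} {K : Set X} {M : ℝ≥0∞} (hK : μH[d] K < M)
    {δ : ℝ≥0∞} (hδ : 0 < δ) : ∃ t : ℕ → Set X, K ⊆ ⋃ n, t n ∧ (∀ n, ediam (t n) ≤ δ) ∧
      ∑' n, ⨆ _ : (t n).Nonempty, ediam (t n) ^ d < M := by
  rw [Measure.hausdorffMeasure_apply] at hK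
  have h := lt_of_le_of_lt (le_iSup₂ (f := fun (r : ℝ≥0∞) (_ : 0 < r) =>
        ⨅ (t : ℕ → Set X) (_ : K ⊆ ⋃ n, t n) (_ : ∀ n, ediam (t n) ≤ r),
          ∑' n, ⨆ _ : (t n).Nonempty, ediam (t n) ^ d) δ hδ) hK
  simp only [iInf_lt_iff] at h
  obtain ⟨t, h1, h2, h3⟩ := h
  exact ⟨t, h1, h2, h3⟩

/-- Eilenberg's inequality: slices of a set of finite Hausdorff `2`-measure by a `1`-Lipschitz
function have integrable Hausdorff `1`-measure. -/
theorem exists_integrable_bound_slices {K : Set X} (hK : μH[2] K ≠ ⊤) {u : X → ℝ}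
    (hu : LipschitzWith 1 u) : ∃ h : ℝ → ℝ≥0∞, Measurable h ∧ ∫⁻ a, h a ≠ ⊤ ∧
      ∀ a, μH[1] (K ∩ u ⁻¹' {a}) ≤ h a := by
  have hlt : μH[2] K < μH[2] K + 1 := ENNReal.lt_add_right hK one_ne_zero
  have := fun n : ℕ => exists_cover_of_hausdorffMeasure_lt hlt
    (δ := ((n : ℝ≥0∞) + 1)⁻¹) (ENNReal.inv_pos.2 (by finiteness))
  choose t ht hd hs using this
  have hJ : ∀ n i, volume (closure (u '' t n i)) ≤ ediam (t n i) := fun n i => by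
    calc volume (closure (u '' t n i)) ≤ ediam (closure (u '' t n i)) := Real.volume_le_diam _
      _ = ediam (u '' t n i) := ediam_closure _
      _ ≤ (1 : ℝ≥0) * ediam (t n i) := hu.ediam_image_le _
      _ = ediam (t n i) := by simp
  set h : ℕ → ℝ → ℝ≥0∞ := fun n a =>
    ∑' i, (closure (u '' t n i)).indicator (fun _ => ediam (t n i)) a with hh
  have hm : ∀ n, Measurable (h n) := fun n => by
    refine Measurable.tsum fun i => ?_
    exact measurable_const.indicator isClosed_closure.measurableSet
  have hbound : ∀ n, ∫⁻ a, h n a ≤ μH[2] K + 1 := fun n => by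
    rw [hh]
    simp only
    rw [lintegral_tsum fun i =>
      (measurable_const.indicator isClosed_closure.measurableSet).aemeasurable]
    refine le_trans (ENNReal.tsum_le_tsum fun i => ?_) (hs n).le
    rw [lintegral_indicator isClosed_closure.measurableSet, setLIntegral_const]
    by_cases hne : (t n i).Nonempty
    · rw [ciSup_pos hne]
      calc _ ≤ ediam (t n i) * ediam (t n i) := by gcongr; exact hJ n i
        _ = _ := by
          rw [← sq]
          exact (ENNReal.rpow_natCast _ 2).symm
    · rw [not_nonempty_iff_eq_empty.1 hne]
      simp
  refine ⟨fun a => liminf (fun n => h n a) atTop, Measurable.liminf hm, ?_, fun a => ?_⟩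
  · refine ne_top_of_le_ne_top (b := μH[2] K + 1) (by finiteness) ?_
    refine (lintegral_liminf_le hm).trans ?_
    refine (liminf_le_liminf (Eventually.of_forall hbound)).trans ?_
    simp
  · refine (Measure.hausdorffMeasure_le_liminf_tsum (l := atTop) 1 (K ∩ u ⁻¹' {a})
      (fun n : ℕ => ((n : ℝ≥0∞) + 1)⁻¹) ?_ (fun n i => t n i ∩ u ⁻¹' {a})
      (Eventually.of_forall fun n i => (ediam_mono inter_subset_left).trans (hd n i))
      (Eventually.of_forall fun n => ?_)).trans ?_
    · have := (tendsto_add_atTop_iff_nat 1).2 ENNReal.tendsto_inv_nat_nhds_zero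
      simpa using this
    · rintro x ⟨hx, hxa⟩
      obtain ⟨i, hi⟩ := mem_iUnion.1 (ht n hx)
      exact mem_iUnion.2 ⟨i, hi, hxa⟩
    · refine liminf_le_liminf (Eventually.of_forall fun n => ?_)
      refine ENNReal.tsum_le_tsum fun i => ?_
      rw [ENNReal.rpow_one]
      by_cases hne : (t n i ∩ u ⁻¹' {a}).Nonempty
      · obtain ⟨x, hx, hxa⟩ := hne
        have hmem : a ∈ closure (u '' t n i) := subset_closure ⟨x, hx, hxa⟩
        rw [indicator_of_mem hmem]
        exact ediam_mono inter_subset_left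
      · rw [not_nonempty_iff_eq_empty.1 hne]
        simp

/-- A compact set of Hausdorff `1`-measure less than `M` has arbitrarily fine finite open covers
with total diameter at most `M`. -/
theorem exists_finite_open_cover {K : Set X} (hKc : IsCompact K) {M : ℝ}
    (hK : μH[1] K < ENNReal.ofReal M) {δ : ℝ} (hδ : 0 < δ) :
    ∃ (F : Finset ℕ) (U : ℕ → Set X) (r : ℕ → ℝ), (∀ i, IsOpen (U i)) ∧ K ⊆ ⋃ i ∈ F, U i ∧
      (∀ i, 0 ≤ r i ∧ r i ≤ δ) ∧ (∀ i, ∀ x ∈ U i, ∀ y ∈ U i, dist x y ≤ r i) ∧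
      ∑ i ∈ F, r i ≤ M := by
  obtain ⟨t, ht, hd, hs⟩ := exists_cover_of_hausdorffMeasure_lt hK
    (δ := ENNReal.ofReal (δ / 2)) (by simpa using hδ)
  have hs' : ∑' n, ediam (t n) < ENNReal.ofReal M := by
    refine lt_of_le_of_lt (ENNReal.tsum_le_tsum fun n => ?_) hs
    by_cases hne : (t n).Nonempty
    · rw [ciSup_pos hne, ENNReal.rpow_one]
    · rw [not_nonempty_iff_eq_empty.1 hne]
      simp
  obtain ⟨ε, hε, hεs⟩ := ENNReal.exists_pos_sum_of_countable
    (ε := ENNReal.ofReal M - ∑' n, ediam (t n)) (tsub_pos_of_lt hs').ne' ℕ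
  let η : ℕ → ℝ := fun n => min (ε n / 2) (δ / 4)
  have hη : ∀ n, 0 < η n := fun n => lt_min (by have := hε n; positivity) (by positivity)
  have hη1 : ∀ n, ediam (thickening (η n) (t n)) ≤ ediam (t n) + 2 * ENNReal.ofReal (η n) :=
    fun n => by
      have := ediam_thickening_le (s := t n) (Real.toNNReal (η n))
      rwa [Real.coe_toNNReal _ (hη n).le] at this
  have hη2 : ∀ n, 2 * ENNReal.ofReal (η n) ≤ ε n := fun n => by
    rw [← ENNReal.ofReal_ofNat 2, ← ENNReal.ofReal_mul (by norm_num), ← ENNReal.ofReal_coe_nnreal]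
    refine ENNReal.ofReal_le_ofReal ?_
    have := min_le_left ((ε n : ℝ) / 2) (δ / 4)
    simp only [η]
    linarith
  have hη3 : ∀ n, ediam (thickening (η n) (t n)) ≤ ENNReal.ofReal δ := fun n => by
    refine (hη1 n).trans ?_
    rw [← ENNReal.ofReal_ofNat 2, ← ENNReal.ofReal_mul (by norm_num)]
    refine (add_le_add_left (hd n) _).trans ?_
    have h1 := hη n
    rw [← ENNReal.ofReal_add (by positivity) (by positivity)]
    refine ENNReal.ofReal_le_ofReal ?_
    have := min_le_right ((ε n : ℝ) / 2) (δ / 4)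
    simp only [η]
    linarith
  obtain ⟨F, hF⟩ := hKc.elim_finite_subcover (fun n => thickening (η n) (t n))
    (fun n => isOpen_thickening)
    (ht.trans (iUnion_mono fun n => self_subset_thickening (hη n) _))
  refine ⟨F, fun n => thickening (η n) (t n), fun n => (ediam (thickening (η n) (t n))).toReal,
    fun n => isOpen_thickening, hF, fun n => ⟨ENNReal.toReal_nonneg, ?_⟩, ?_, ?_⟩
  · exact ENNReal.toReal_le_of_le_ofReal hδ.le (hη3 n)
  · intro i x hx y hy
    have h1 : edist x y ≤ ediam (thickening (η i) (t i)) := edist_le_ediam_of_mem hx hy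
    rw [dist_edist]
    exact ENNReal.toReal_mono (ne_top_of_le_ne_top ENNReal.ofReal_ne_top (hη3 i)) h1
  · rw [← ENNReal.toReal_sum fun i _ => ne_top_of_le_ne_top ENNReal.ofReal_ne_top (hη3 i)]
    have hM : 0 < M := by
      by_contra! h
      rw [ENNReal.ofReal_of_nonpos h] at hK
      exact absurd hK _root_.not_lt_zero
    refine ENNReal.toReal_le_of_le_ofReal hM.le ?_
    calc ∑ i ∈ F, ediam (thickening (η i) (t i))
        ≤ ∑' i, ediam (thickening (η i) (t i)) := ENNReal.sum_le_tsum _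
      _ ≤ ∑' i, (ediam (t i) + ε i) :=
        ENNReal.tsum_le_tsum fun i => (hη1 i).trans (by gcongr; exact hη2 i)
      _ = ∑' i, ediam (t i) + ∑' i, (ε i : ℝ≥0∞) := ENNReal.tsum_add
      _ ≤ ∑' i, ediam (t i) + (ENNReal.ofReal M - ∑' n, ediam (t n)) := by gcongr
      _ = ENNReal.ofReal M := add_tsub_cancel_of_le hs'.le

end HausdorffCovers

section Curves

variable {X : Type*} [MetricSpace X]

/-- An ultrafilter limit, along the natural numbers, of points in a compact set. -/
theorem exists_ultrafilter_limit {α : Type*} {Z : Set X} (hZ : IsCompact Z) (f : ℕ → α → X)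
    (hf : ∀ n s, f n s ∈ Z) : ∃ g : α → X, ∀ s, g s ∈ Z ∧
      Tendsto (fun n => f n s) (hyperfilter ℕ : Filter ℕ) (𝓝 (g s)) := by
  have : ∀ s, ∃ x ∈ Z, Tendsto (fun n => f n s) (hyperfilter ℕ : Filter ℕ) (𝓝 x) := fun s => by
    have := hZ.ultrafilter_le_nhds ((hyperfilter ℕ).map fun n => f n s) (by
      rw [le_principal_iff]
      exact mem_map.2 (Eventually.of_forall fun n => hf n s))
    obtain ⟨x, hx, hle⟩ := this
    exact ⟨x, hx, hle⟩
  choose g hg using this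
  exact ⟨g, hg⟩

theorem hyperfilter_le_atTop : (hyperfilter ℕ : Filter ℕ) ≤ atTop := by
  rw [← Nat.cofinite_eq_atTop]
  exact hyperfilter_le_cofinite

theorem exists_limit_curve {Z : Set X} (hZ : IsCompact Z) (f : ℕ → ℝ → X)
    (hf : ∀ n s, f n s ∈ Z) {L ε : ℕ → ℝ} {L₀ : ℝ} (hL : Tendsto L atTop (𝓝 L₀))
    (hε : Tendsto ε atTop (𝓝 0)) (hd : ∀ n s t, dist (f n s) (f n t) ≤ L n * |s - t| + ε n) :
    ∃ g : ℝ → X, (∀ s, g s ∈ Z) ∧ (∀ s t, dist (g s) (g t) ≤ L₀ * |s - t|) ∧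
      ∀ s x, (∀ n, f n s = x) → g s = x := by
  obtain ⟨g, hg⟩ := exists_ultrafilter_limit hZ f hf
  refine ⟨g, fun s => (hg s).1, fun s t => ?_, fun s x h => ?_⟩
  · have h1 : Tendsto (fun n => L n * |s - t| + ε n) (hyperfilter ℕ : Filter ℕ)
        (𝓝 (L₀ * |s - t| + 0)) :=
      ((hL.mul_const _).add hε).mono_left hyperfilter_le_atTop
    rw [add_zero] at h1
    exact le_of_tendsto_of_tendsto' ((hg s).2.dist (hg t).2) h1 fun n => hd n s t
  · have := (hg s).2
    simp only [h] at this
    exact (tendsto_nhds_unique this tendsto_const_nhds)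

/-- `f` is a coarse curve of length `t` and mesh `ε` in `Z` from `x` to `y`. -/
def IsCoarseCurve (Z : Set X) (ε : ℝ) (x : X) (f : ℝ → X) (t : ℝ) (y : X) : Prop :=
  (∀ s, f s ∈ Z) ∧ (∀ s ≤ 0, f s = x) ∧ (∀ s, t ≤ s → f s = y) ∧
    ∀ s s', dist (f s) (f s') ≤ |s - s'| + ε

theorem IsCoarseCurve.extend {Z : Set X} {ε : ℝ} {x : X} {f : ℝ → X} {t : ℝ} {y z : X}
    (h : IsCoarseCurve Z ε x f t y) (ht : 0 ≤ t) {r : ℝ} (hr : 0 < r) (hrε : r ≤ ε)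
    (hz : z ∈ Z) (hyz : dist y z ≤ r) : ∃ f', IsCoarseCurve Z ε x f' (t + r) z := by
  obtain ⟨h1, h2, h3, h4⟩ := h
  have key : ∀ s s', s < t + r → t + r ≤ s' → dist (f s) z ≤ |s - s'| + ε := by
    intro s s' hs hs'
    rw [abs_of_neg (by linarith)]
    rcases le_total s t with hst | hst
    · have := h4 s t
      rw [abs_of_nonpos (by linarith), h3 t le_rfl] at this
      linarith [dist_triangle (f s) y z]
    · rw [h3 s hst]
      linarith
  refine ⟨fun s => if s < t + r then f s else z, fun s => ?_, fun s hs => ?_, fun s hs => ?_,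
    fun s s' => ?_⟩
  · dsimp only
    split_ifs
    exacts [h1 s, hz]
  · simp only [show s < t + r by linarith, if_true]
    exact h2 s hs
  · simp only [not_lt.2 hs, if_false]
  · dsimp only
    split_ifs with ha hb hb
    · exact h4 s s'
    · exact key s s' ha (not_lt.1 hb)
    · rw [dist_comm, abs_sub_comm]
      exact key s' s hb (not_lt.1 ha)
    · rw [dist_self]
      have := abs_nonneg (s - s')
      linarith

theorem IsCoarseCurve.extend_walk {ι : Type*} {Z : Set X} {ε : ℝ} {x : X} {U : ι → Set X}
    {r : ι → ℝ} (hr : ∀ i, 0 < r i ∧ r i ≤ ε) (hU : ∀ i, ∀ x ∈ U i, ∀ y ∈ U i, dist x y ≤ r i)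
    {G : SimpleGraph ι} (hG : ∀ i j, G.Adj i j → (Z ∩ (U i ∩ U j)).Nonempty) {i j : ι}
    (p : G.Walk i j) : ∀ (t : ℝ) (_ : 0 ≤ t) (z : X) (_ : z ∈ U i) (f : ℝ → X)
      (_ : IsCoarseCurve Z ε x f t z), ∀ y ∈ U j, y ∈ Z →
      ∃ f', IsCoarseCurve Z ε x f' (t + (p.support.map r).sum) y := by
  induction p with
  | nil =>
    intro t ht z hz f hf y hy hyZ
    simp only [SimpleGraph.Walk.support_nil, List.map_cons, List.map_nil, List.sum_cons,
      List.sum_nil, add_zero]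
    exact hf.extend ht (hr _).1 (hr _).2 hyZ (hU _ _ hz _ hy)
  | cons h p ih =>
    intro t ht z hz f hf y hy hyZ
    obtain ⟨z', hz', hz1, hz2⟩ := hG _ _ h
    obtain ⟨f', hf'⟩ := hf.extend ht (hr _).1 (hr _).2 hz' (hU _ _ hz _ hz1)
    obtain ⟨f'', hf''⟩ := ih _ (add_nonneg ht (hr _).1.le) z' hz2 f' hf' y hy hyZ
    refine ⟨f'', ?_⟩
    simpa [add_assoc] using hf''

theorem exists_coarseCurve {ι : Type*} [Fintype ι] {Z : Set X} (hZ : IsPreconnected Z) {ε M : ℝ}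
    {x y : X} (hx : x ∈ Z) (hy : y ∈ Z) {U : ι → Set X} (hUo : ∀ i, IsOpen (U i))
    (hZU : Z ⊆ ⋃ i, U i) {r : ι → ℝ} (hr : ∀ i, 0 < r i ∧ r i ≤ ε)
    (hU : ∀ i, ∀ x ∈ U i, ∀ y ∈ U i, dist x y ≤ r i) (hM : ∑ i, r i ≤ M) :
    ∃ f, IsCoarseCurve Z ε x f M y := by
  classical
  let G : SimpleGraph ι :=
    { Adj := fun i j => i ≠ j ∧ (Z ∩ (U i ∩ U j)).Nonempty
      symm := ⟨fun i j h => ⟨h.1.symm, by rw [inter_comm (U j)]; exact h.2⟩⟩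
      loopless := ⟨fun i h => h.1 rfl⟩ }
  obtain ⟨i, hi⟩ := mem_iUnion.1 (hZU hx)
  obtain ⟨j, hj⟩ := mem_iUnion.1 (hZU hy)
  have hij : G.Reachable i j := by
    by_contra hnot
    obtain ⟨w, hw, hw1, hw2⟩ := hZ (⋃ k ∈ {k | G.Reachable i k}, U k)
      (⋃ k ∈ {k | ¬ G.Reachable i k}, U k) (isOpen_biUnion fun k _ => hUo k)
      (isOpen_biUnion fun k _ => hUo k)
      (fun w hw => by
        obtain ⟨k, hk⟩ := mem_iUnion.1 (hZU hw)
        by_cases h : G.Reachable i k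
        · exact Or.inl (mem_biUnion (show k ∈ {k | G.Reachable i k} from h) hk)
        · exact Or.inr (mem_biUnion (show k ∈ {k | ¬ G.Reachable i k} from h) hk))
      ⟨x, hx, mem_biUnion (show i ∈ {k | G.Reachable i k} from SimpleGraph.Reachable.refl i) hi⟩
      ⟨y, hy, mem_biUnion (show j ∈ {k | ¬ G.Reachable i k} from hnot) hj⟩
    simp only [mem_iUnion, mem_ofPred_eq] at hw1 hw2
    obtain ⟨k, hk, hwk⟩ := hw1
    obtain ⟨l, hl, hwl⟩ := hw2
    refine hl (hk.trans (SimpleGraph.Adj.reachable ⟨?_, w, hw, hwk, hwl⟩))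
    rintro rfl
    exact hl hk
  obtain ⟨p, hp⟩ := hij.exists_isPath
  have hε : 0 ≤ ε := (hr i).1.le.trans (hr i).2
  obtain ⟨f, hf⟩ := IsCoarseCurve.extend_walk hr hU (G := G) (fun i j h => h.2) p 0 le_rfl x hi
    (fun _ => x) ⟨fun _ => hx, fun _ _ => rfl, fun _ _ => rfl, fun s s' => by
      rw [dist_self]; positivity⟩ y hj hy
  refine ⟨f, hf.1, hf.2.1, fun s hs => hf.2.2.1 s (le_trans ?_ hs), hf.2.2.2⟩
  rw [zero_add, ← List.sum_toFinset r hp.support_nodup]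
  exact (Finset.sum_le_sum_of_subset_of_nonneg (Finset.subset_univ _)
    fun k _ _ => (hr k).1.le).trans hM

/-- Continua of Hausdorff `1`-measure less than `M` are connected by `M`-Lipschitz curves. -/
theorem exists_lipschitz_curve [MeasurableSpace X] [BorelSpace X] {Z : Set X} (hZ : IsCompact Z)
    (hZc : IsPreconnected Z) {M : ℝ} (hM : μH[1] Z < ENNReal.ofReal M) {x y : X} (hx : x ∈ Z)
    (hy : y ∈ Z) : ∃ γ : ℝ → X, (∀ s, γ s ∈ Z) ∧ γ 0 = x ∧ γ 1 = y ∧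
      ∀ s t, dist (γ s) (γ t) ≤ M * |s - t| := by
  obtain ⟨M', hMM', hM'⟩ : ∃ M', μH[1] Z < ENNReal.ofReal M' ∧ M' < M := by
    have hM0 : 0 < M := by
      by_contra! h
      rw [ENNReal.ofReal_of_nonpos h] at hM
      exact absurd hM _root_.not_lt_zero
    obtain ⟨c, hc1, hc2⟩ := exists_between hM
    lift c to ℝ≥0 using (hc2.trans ENNReal.ofReal_lt_top).ne
    refine ⟨c, by simpa using hc1, ?_⟩
    rw [← ENNReal.ofReal_coe_nnreal] at hc2
    exact (ENNReal.ofReal_lt_ofReal_iff hM0).1 hc2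
  have hM0 : 0 ≤ M := by
    by_contra! h
    rw [ENNReal.ofReal_of_nonpos h.le] at hM
    exact absurd hM _root_.not_lt_zero
  have : ∀ n : ℕ, ∃ f, IsCoarseCurve Z (2 / ((n : ℝ) + 1)) x f M y := by
    intro n
    obtain ⟨F, U, r, hUo, hZU, hr, hU, hs⟩ := exists_finite_open_cover hZ hMM'
      (δ := 1 / ((n : ℝ) + 1)) (by positivity)
    let c : ℝ := min (1 / ((n : ℝ) + 1)) ((M - M') / (F.card + 1))
    have hc : 0 < c := lt_min (by positivity) (div_pos (by linarith) (by positivity))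
    refine exists_coarseCurve (ι := F) hZc hx hy (U := fun i => U i) (fun i => hUo i)
      (fun z hz => ?_) (r := fun i => r i + c) (fun i => ⟨by linarith [(hr i).1], ?_⟩)
      (fun i x hx y hy => by linarith [hU i x hx y hy]) ?_
    · obtain ⟨i, hi, hzi⟩ := mem_iUnion₂.1 (hZU hz)
      exact mem_iUnion.2 ⟨⟨i, hi⟩, hzi⟩
    · have h1 := (hr i).2
      have h2 : c ≤ 1 / ((n : ℝ) + 1) := min_le_left _ _
      have h3 : 2 / ((n : ℝ) + 1) = 1 / ((n : ℝ) + 1) + 1 / ((n : ℝ) + 1) := by ring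
      linarith
    · rw [Finset.sum_coe_sort F (fun i => r i + c), Finset.sum_add_distrib, Finset.sum_const,
        nsmul_eq_mul]
      have h2 : c ≤ (M - M') / (F.card + 1) := min_le_right _ _
      have h3 : (F.card : ℝ) * c ≤ M - M' := by
        have h4 := (le_div_iff₀ (by positivity)).1 h2
        nlinarith
      linarith
  choose f hf using this
  obtain ⟨γ, h1, h2, h3⟩ := exists_limit_curve hZ (fun n s => f n (M * s))
    (fun n s => (hf n).1 _) (L := fun _ => M) (ε := fun n : ℕ => 2 / ((n : ℝ) + 1))
    tendsto_const_nhds (by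
      have := (tendsto_one_div_add_atTop_nhds_zero_nat (𝕜 := ℝ)).const_mul 2
      simpa [mul_one_div, div_eq_mul_inv] using this) (fun n s t => by
      refine ((hf n).2.2.2 _ _).trans ?_
      rw [← mul_sub, abs_mul, abs_of_nonneg hM0])
  exact ⟨γ, h1, h3 _ _ fun n => (hf n).2.1 _ (by simp), h3 _ _ fun n => (hf n).2.2.1 _ (by simp),
    h2⟩

/-- A Lipschitz curve between distinct points may be chosen injective. -/
theorem exists_injective_lipschitz_curve {Z : Set X} (hZ : IsCompact Z) {M : ℝ} {x y : X}
    (hxy : x ≠ y) (h : ∃ γ : ℝ → X, (∀ s, γ s ∈ Z) ∧ γ 0 = x ∧ γ 1 = y ∧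
      ∀ s t, dist (γ s) (γ t) ≤ M * |s - t|) :
    ∃ γ : ℝ → X, (∀ s, γ s ∈ Z) ∧ γ 0 = x ∧ γ 1 = y ∧
      (∀ s t, dist (γ s) (γ t) ≤ M * |s - t|) ∧ InjOn γ (Icc 0 1) := by
  set A : Set ℝ := {L | ∃ γ : ℝ → X, (∀ s, γ s ∈ Z) ∧ γ 0 = x ∧ γ 1 = y ∧
      ∀ s t, dist (γ s) (γ t) ≤ L * |s - t|} with hA
  have hpos : ∀ L ∈ A, dist x y ≤ L := by
    rintro L ⟨γ, -, h0, h1, hd⟩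
    have := hd 0 1
    rw [h0, h1] at this
    simpa using this
  have hbdd : BddBelow A := ⟨dist x y, hpos⟩
  obtain ⟨L, -, hL, hLA⟩ := exists_seq_tendsto_sInf ⟨M, h⟩ hbdd
  choose f hf using hLA
  obtain ⟨γ, h1, h2, h3⟩ := exists_limit_curve hZ f (fun n => (hf n).1) hL
    (ε := fun _ => 0) tendsto_const_nhds (fun n s t => by
      rw [add_zero]; exact (hf n).2.2.2 s t)
  have hγ0 := h3 0 x fun n => (hf n).2.1
  have hγ1 := h3 1 y fun n => (hf n).2.2.1
  set c := sInf A
  have hc : 0 < c := by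
    have := h2 0 1
    rw [hγ0, hγ1] at this
    have h' := dist_pos.2 hxy
    simp at this
    linarith
  have hcM : c ≤ M := csInf_le hbdd h
  have key : ∀ s t, 0 ≤ s → s < t → t ≤ 1 → γ s ≠ γ t := by
    intro s t hs hst ht heq
    set l := 1 - (t - s) with hl
    have hl1 : l < 1 := by linarith
    have hl0 : 0 ≤ l := by linarith
    have hmem : c * l ∈ A := by
      have aux : ∀ w w', w ≤ s → s < w' → dist (γ w) (γ (w' + (t - s))) ≤ c * |w - w'| := by
        intro w w' hw hw'
        have e1 := h2 w s
        have e2 := h2 t (w' + (t - s))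
        rw [← heq] at e2
        rw [abs_of_nonpos (by linarith)] at e1 e2 ⊢
        have := dist_triangle (γ w) (γ s) (γ (w' + (t - s)))
        nlinarith
      refine ⟨fun r => if l * r ≤ s then γ (l * r) else γ (l * r + (t - s)), fun r => ?_, ?_, ?_,
        fun r r' => ?_⟩
      · dsimp only
        split_ifs <;> exact h1 _
      · simp [hs, hγ0]
      · simp only [mul_one]
        split_ifs with hls
        · have h4 : t = 1 := by linarith
          have h5 : l = s := by linarith
          rw [h5, heq, h4, hγ1]
        · rw [hl, sub_add_cancel, hγ1]
      · have e : c * l * |r - r'| = c * |l * r - l * r'| := by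
          rw [← mul_sub, abs_mul, abs_of_nonneg hl0, mul_assoc]
        rw [e]
        dsimp only
        split_ifs with ha hb hb
        · exact h2 _ _
        · exact aux _ _ ha (not_le.1 hb)
        · rw [dist_comm, abs_sub_comm]
          exact aux _ _ hb (not_le.1 ha)
        · have := h2 (l * r + (t - s)) (l * r' + (t - s))
          rwa [add_sub_add_right_eq_sub] at this
    have := csInf_le hbdd hmem
    nlinarith
  refine ⟨γ, h1, hγ0, hγ1, fun s t => (h2 s t).trans (by gcongr), ?_⟩
  intro s hs t ht heq
  rcases lt_trichotomy s t with h | h | h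
  · exact absurd heq (key s t hs.1 h ht.2)
  · exact h
  · exact absurd heq.symm (key t s ht.1 h hs.2)

end Curves

section LevelCurves

open unitInterval

variable {X : Type*} [MetricSpace X] [MeasurableSpace X] [BorelSpace X]

/-- For a positive measure set of levels, the level sets of `u` contain Lipschitz arcs which join
the bottom to the top side of the square and have a uniform Lipschitz constant. -/
theorem exists_level_curves {e : I × I → X} (he : Continuous e) (hinj : Function.Injective e)
    (hfin : μH[2] (range e) ≠ ⊤) {u : X → ℝ} (hu : LipschitzWith 1 u) {ε : ℝ} (hε : 0 < ε)
    (hL : ∀ y, u (e (0, y)) = 0) (hR : ∀ y, ε < u (e (1, y))) :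
    ∃ (L : ℝ) (A : Set ℝ) (p : ℝ → I) (α : ℝ → ℝ → I × I), A ⊆ Ioo 0 ε ∧ MeasurableSet A ∧
      volume A ≠ 0 ∧ StrictMonoOn p A ∧ ∀ a ∈ A, Continuous (α a) ∧ InjOn (α a) (Icc 0 1) ∧
        α a 0 = (p a, 0) ∧ (α a 1).2 = 1 ∧ (∀ s, u (e (α a s)) = a) ∧
        ∀ s t, dist (e (α a s)) (e (α a t)) ≤ L * |s - t| := by
  obtain ⟨h, hm, hh, hle⟩ := exists_integrable_bound_slices hfin hu
  obtain ⟨Z, p, q, hp, hZ⟩ := exists_level_continua (hu.continuous.comp he) hL hR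
  have hAm : ∀ n : ℕ, MeasurableSet (Ioo 0 ε ∩ {a | h a < n}) := fun n =>
    measurableSet_Ioo.inter (measurableSet_lt hm measurable_const)
  obtain ⟨n, hn⟩ : ∃ n : ℕ, volume (Ioo 0 ε ∩ {a | h a < n}) ≠ 0 := by
    by_contra! hall
    have h1 : volume (⋃ n : ℕ, Ioo 0 ε ∩ {a | h a < n}) = 0 := measure_iUnion_null hall
    have h2 : ∀ᵐ a, h a < ⊤ := ae_lt_top hm hh
    have h3 : volume (Ioo 0 ε) = 0 := by
      refine measure_mono_null (t := (⋃ n : ℕ, Ioo 0 ε ∩ {a | h a < n}) ∪ {a | ¬ h a < ⊤})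
        (fun a ha => ?_) (measure_union_null h1 h2)
      by_cases hlt : h a < ⊤
      · obtain ⟨n, hn⟩ := ENNReal.exists_nat_gt hlt.ne
        exact Or.inl (mem_iUnion.2 ⟨n, ha, hn⟩)
      · exact Or.inr hlt
    rw [Real.volume_Ioo] at h3
    simp at h3
    linarith
  have hce : IsClosedEmbedding e := he.isClosedEmbedding hinj
  have hex : ∀ a, ∃ α : ℝ → I × I, a ∈ Ioo 0 ε ∩ {a | h a < n} →
      Continuous α ∧ InjOn α (Icc 0 1) ∧
        α 0 = (p a, 0) ∧ (α 1).2 = 1 ∧ (∀ s, u (e (α s)) = a) ∧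
        ∀ s t, dist (e (α s)) (e (α t)) ≤ n * |s - t| := by
    intro a
    by_cases ha : a ∈ Ioo 0 ε ∩ {a | h a < n}
    swap
    · exact ⟨fun _ => 0, fun h => absurd h ha⟩
    obtain ⟨hZ1, hZ2, hZ3, hZ4, hZ5⟩ := hZ a ha.1
    have hH : μH[1] (e '' Z a) < ENNReal.ofReal n := by
      rw [ENNReal.ofReal_natCast]
      refine lt_of_le_of_lt ((measure_mono ?_).trans (hle a)) ha.2
      rintro _ ⟨z, hz, rfl⟩
      exact ⟨mem_range_self _, hZ3 z hz⟩
    have hne : e (p a, 0) ≠ e (q a, 1) := fun h => by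
      have := congr_arg Prod.snd (hinj h)
      exact zero_ne_one this
    obtain ⟨γ, h1, h2, h3, h4, h5⟩ := exists_injective_lipschitz_curve (hZ1.image he) hne
      (exists_lipschitz_curve (hZ1.image he) (hZ2.image _ he.continuousOn) hH
        (mem_image_of_mem _ hZ4) (mem_image_of_mem _ hZ5))
    choose α hα hαγ using h1
    have hγ : Continuous γ := by
      refine (LipschitzWith.of_dist_le_mul (K := n) fun s t => ?_).continuous
      rw [Real.dist_eq]
      exact_mod_cast h4 s t
    refine ⟨α, fun _ => ⟨?_, ?_, ?_, ?_, ?_, ?_⟩⟩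
    · rw [hce.isEmbedding.continuous_iff]
      convert! hγ using 1
      exact funext hαγ
    · intro s hs t ht hst
      exact h5 hs ht (by rw [← hαγ s, ← hαγ t, hst])
    · exact hinj (by rw [hαγ, h2])
    · have : α 1 = (q a, 1) := hinj (by rw [hαγ, h3])
      rw [this]
    · exact fun s => hZ3 _ (hα s)
    · intro s t
      rw [hαγ, hαγ]
      exact h4 s t
  choose α hα using hex
  exact ⟨n, _, p, α, inter_subset_left, hAm n, hn, hp.mono inter_subset_left, hα⟩

theorem joinedIn_image_Icc {Y : Type*} [TopologicalSpace Y] {c : ℝ → Y} (hc : Continuous c)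
    {s t : ℝ} (h : s ≤ t) : JoinedIn (c '' Icc s t) (c s) (c t) :=
  (((convex_Icc s t).isPathConnected (nonempty_Icc.2 h)).image hc).joinedIn _
    (mem_image_of_mem _ (left_mem_Icc.2 h)) _ (mem_image_of_mem _ (right_mem_Icc.2 h))

theorem joinedIn_union {Y : Type*} [TopologicalSpace Y] {F G : Set Y} {x y z : Y}
    (h : JoinedIn F x y) (h' : JoinedIn G y z) : JoinedIn (F ∪ G) x z :=
  (h.mono subset_union_left).trans (h'.mono subset_union_right)

/-- First hitting time of one arc by another. -/
theorem exists_first_hit {α γ : ℝ → I × I} (hα : Continuous α) (hγ : Continuous γ)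
    (hα0 : (α 0).2 = 0) (hα1 : (α 1).2 = 1) (hγ0 : (γ 0).1 = 0) (hγ1 : (γ 1).1 = 1) :
    ∃ τ ∈ Icc (0 : ℝ) 1, ∃ sig ∈ Icc (0 : ℝ) 1, γ τ = α sig ∧
      ∀ t ∈ Icc (0 : ℝ) 1, ∀ s ∈ Icc (0 : ℝ) 1, γ t = α s → τ ≤ t := by
  have hcl : IsCompact (Icc 0 1 ∩ γ ⁻¹' (α '' Icc 0 1)) :=
    isCompact_Icc.inter_right ((isCompact_Icc.image hα).isClosed.preimage hγ)
  have hne : (Icc 0 1 ∩ γ ⁻¹' (α '' Icc 0 1)).Nonempty := by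
    by_contra hne
    rw [not_nonempty_iff_eq_empty] at hne
    refine crossing ?_ (joinedIn_image_Icc hγ zero_le_one) hγ0 hγ1
      (joinedIn_image_Icc hα zero_le_one) hα0 hα1
    rw [Set.disjoint_left]
    rintro _ ⟨t, ht, rfl⟩ h
    have : t ∈ Icc 0 1 ∩ γ ⁻¹' (α '' Icc 0 1) := ⟨ht, h⟩
    rw [hne] at this
    exact this
  obtain ⟨τ, ⟨hτ, sig, hsig, hsτ⟩, hmin⟩ := hcl.exists_isLeast hne
  exact ⟨τ, hτ, sig, hsig, hsτ.symm, fun t ht s hs h => hmin ⟨ht, s, hs, h.symm⟩⟩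

/-- A square of finite measure carries two transversal families of arcs, whose intersection points
are monotone along each arc. -/
theorem exists_transversal_families {e : I × I → X} (he : Continuous e)
    (hinj : Function.Injective e) (hfin : μH[2] (range e) ≠ ⊤) {u v : X → ℝ}
    (hu : LipschitzWith 1 u) (hv : LipschitzWith 1 v) {ε : ℝ} (hε : 0 < ε)
    (hL : ∀ y, u (e (0, y)) = 0) (hR : ∀ y, ε < u (e (1, y)))
    (hB : ∀ x, v (e (x, 0)) = 0) (hT : ∀ x, ε < v (e (x, 1))) :
    ∃ (L : ℝ) (A B : Set ℝ) (g : ℝ → ℝ → X), A ⊆ Ioo 0 ε ∧ B ⊆ Ioo 0 ε ∧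
      MeasurableSet A ∧ MeasurableSet B ∧ volume A ≠ 0 ∧ volume B ≠ 0 ∧
      (∀ a ∈ A, ∀ b ∈ B, g a b ∈ range e ∧ u (g a b) = a ∧ v (g a b) = b) ∧
      (∀ b ∈ B, ∃ (c : ℝ → X) (τ : ℝ → ℝ), (∀ s t, dist (c s) (c t) ≤ L * |s - t|) ∧
        MonotoneOn τ A ∧ (∀ a ∈ A, τ a ∈ Icc (0 : ℝ) 1) ∧ ∀ a ∈ A, g a b = c (τ a)) ∧
      (∀ a ∈ A, ∃ (c : ℝ → X) (τ : ℝ → ℝ), (∀ s t, dist (c s) (c t) ≤ L * |s - t|) ∧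
        MonotoneOn τ B ∧ (∀ b ∈ B, τ b ∈ Icc (0 : ℝ) 1) ∧ ∀ b ∈ B, g a b = c (τ b)) := by
  obtain ⟨L₁, A, p, α, hA, hAm, hA0, hp, hα⟩ :=
    exists_level_curves he hinj hfin hu hε hL hR
  obtain ⟨L₂, B, l, β, hBs, hBm, hB0, hl, hβ⟩ :=
    exists_level_curves (e := e ∘ Prod.swap) (he.comp continuous_swap)
      (hinj.comp Prod.swap_injective) (by rwa [Prod.swap_surjective.range_comp]) hv hε hB hT
  let γ : ℝ → ℝ → I × I := fun b t => (β b t).swap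
  have hγc : ∀ b ∈ B, Continuous (γ b) := fun b hb => continuous_swap.comp (hβ b hb).1
  have hγ0 : ∀ b ∈ B, γ b 0 = (0, l b) := fun b hb => by
    simp only [γ]
    rw [(hβ b hb).2.2.1]
    rfl
  have hγ1 : ∀ b ∈ B, (γ b 1).1 = 1 := fun b hb => (hβ b hb).2.2.2.1
  have hγv : ∀ b ∈ B, ∀ t, v (e (γ b t)) = b := fun b hb => (hβ b hb).2.2.2.2.1
  have hγd : ∀ b ∈ B, ∀ s t, dist (e (γ b s)) (e (γ b t)) ≤ L₂ * |s - t| := fun b hb =>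
    (hβ b hb).2.2.2.2.2
  have hex : ∀ a b, ∃ τ sig, a ∈ A → b ∈ B → τ ∈ Icc (0 : ℝ) 1 ∧ sig ∈ Icc (0 : ℝ) 1 ∧
      γ b τ = α a sig ∧ ∀ t ∈ Icc (0 : ℝ) 1, ∀ s ∈ Icc (0 : ℝ) 1, γ b t = α a s → τ ≤ t := by
    intro a b
    by_cases h : a ∈ A ∧ b ∈ B
    · obtain ⟨τ, hτ, sig, hsig, h'⟩ := exists_first_hit (hα a h.1).1 (hγc b h.2)
        (by rw [(hα a h.1).2.2.1]) (hα a h.1).2.2.2.1 (by rw [hγ0 b h.2]) (hγ1 b h.2)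
      exact ⟨τ, sig, fun _ _ => ⟨hτ, hsig, h'⟩⟩
    · exact ⟨0, 0, fun h1 h2 => absurd ⟨h1, h2⟩ h⟩
  choose τ sig hτs using hex
  refine ⟨max L₁ L₂, A, B, fun a b => e (γ b (τ a b)), hA, hBs, hAm, hBm, hA0, hB0,
    fun a ha b hb => ⟨mem_range_self _, ?_, hγv b hb _⟩, fun b hb => ?_, fun a ha => ?_⟩
  · simpa only [(hτs a b ha hb).2.2.1] using (hα a ha).2.2.2.2.1 _
  · refine ⟨fun t => e (γ b t), fun a => τ a b, fun s t => (hγd b hb s t).trans ?_, ?_,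
      fun a ha => (hτs a b ha hb).1, fun a ha => rfl⟩
    · gcongr
      exact le_max_right _ _
    · intro a ha a' ha' haa'
      rcases haa'.eq_or_lt with rfl | haa'
      · exact le_rfl
      by_contra! hlt
      obtain ⟨h1, h2, h3, h4⟩ := hτs a b ha hb
      obtain ⟨h1', h2', h3', h4'⟩ := hτs a' b ha' hb
      have hG : JoinedIn ((α a') '' Icc 0 (sig a' b) ∪ γ b '' Icc 0 (τ a' b))
          (α a' 0) (γ b 0) :=
        joinedIn_union (joinedIn_image_Icc (hα a' ha').1 h2'.1)
          (h3' ▸ (joinedIn_image_Icc (hγc b hb) h1'.1).symm)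
      refine separation ?_ (joinedIn_image_Icc (hα a ha).1 zero_le_one) (by rw [(hα a ha).2.2.1])
        (Or.inl (hα a ha).2.2.2.1) hG (by rw [(hα a' ha').2.2.1]) (by rw [hγ0 b hb]) (by
          rw [(hα a ha).2.2.1, (hα a' ha').2.2.1]
          exact hp ha ha' haa')
      rw [Set.disjoint_left]
      rintro _ ⟨s, hs, rfl⟩ (⟨s', hs', hss⟩ | ⟨t, ht, hts⟩)
      · have e1 := (hα a ha).2.2.2.2.1 s
        rw [← hss, (hα a' ha').2.2.2.2.1] at e1
        exact haa'.ne' e1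
      · have := h4 t ⟨ht.1, ht.2.trans h1'.2⟩ s hs hts
        linarith [ht.2]
  · refine ⟨fun t => e (α a t), fun b => sig a b, fun s t => ((hα a ha).2.2.2.2.2 s t).trans ?_, ?_,
      fun b hb => (hτs a b ha hb).2.1, fun b hb => congrArg e (hτs a b ha hb).2.2.1⟩
    · gcongr
      exact le_max_left _ _
    · intro b hb b' hb' hbb'
      rcases hbb'.eq_or_lt with rfl | hbb'
      · exact le_rfl
      by_contra! hlt
      obtain ⟨h1, h2, h3, h4⟩ := hτs a b ha hb
      obtain ⟨h1', h2', h3', h4'⟩ := hτs a b' ha hb'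
      have hinjα := (hα a ha).2.1
      have hαc := (hα a ha).1
      have hF : JoinedIn (γ b '' Icc 0 (τ a b) ∪ α a '' Icc (sig a b) 1) (γ b 0) (α a 1) :=
        joinedIn_union (joinedIn_image_Icc (hγc b hb) h1.1)
          (h3 ▸ joinedIn_image_Icc hαc h2.2)
      have hG : JoinedIn ((γ b') '' Icc 0 (τ a b') ∪ α a '' Icc 0 (sig a b'))
          (γ b' 0) (α a 0) :=
        joinedIn_union (joinedIn_image_Icc (hγc b' hb') h1'.1)
          (h3' ▸ (joinedIn_image_Icc hαc h2'.1).symm)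
      have hdisj : Disjoint (γ b '' Icc 0 (τ a b) ∪ α a '' Icc (sig a b) 1)
          ((γ b') '' Icc 0 (τ a b') ∪ α a '' Icc 0 (sig a b')) := by
        rw [Set.disjoint_left]
        rintro _ (⟨t, ht, rfl⟩ | ⟨s, hs, rfl⟩) (⟨t', ht', htt⟩ | ⟨s', hs', hss⟩)
        · have e1 := hγv b hb t
          rw [← htt, hγv b' hb'] at e1
          exact hbb'.ne' e1
        · have hs1 : s' ∈ Icc (0 : ℝ) 1 := ⟨hs'.1, hs'.2.trans h2'.2⟩
          have e1 := h4 t ⟨ht.1, ht.2.trans h1.2⟩ s' hs1 hss.symm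
          have e2 : t = τ a b := le_antisymm ht.2 e1
          rw [e2, h3] at hss
          have := hinjα hs1 h2 hss
          linarith [hs'.2]
        · have hs1 : s ∈ Icc (0 : ℝ) 1 := ⟨h2.1.trans hs.1, hs.2⟩
          have e1 := h4' t' ⟨ht'.1, ht'.2.trans h1'.2⟩ s hs1 htt
          have e2 : t' = τ a b' := le_antisymm ht'.2 e1
          rw [e2, h3'] at htt
          have := hinjα h2' hs1 htt
          linarith [hs.1]
        · have := hinjα ⟨hs'.1, hs'.2.trans h2'.2⟩ ⟨h2.1.trans hs.1, hs.2⟩ hss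
          linarith [hs.1, hs'.2]
      have hsw : ∀ (S : Set (I × I)) x y, JoinedIn S x y →
          JoinedIn (Prod.swap '' S) x.swap y.swap := by
        rintro S x y ⟨f, hf⟩
        exact ⟨f.map continuous_swap, fun t => mem_image_of_mem _ (hf t)⟩
      refine separation ((Set.disjoint_image_iff Prod.swap_injective).2 hdisj)
        (hsw _ _ _ hF) ?_ (Or.inr ?_) (hsw _ _ _ hG) ?_ ?_ ?_
      · simp [hγ0 b hb]
      · simp [(hα a ha).2.2.2.1]
      · simp [hγ0 b' hb']
      · simp [(hα a ha).2.2.1]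
      · simpa [hγ0 b hb, hγ0 b' hb'] using hl hb hb' hbb'

end LevelCurves

section Grid

variable {X : Type*} [MetricSpace X]

theorem exists_monotone_extension_Icc {f : ℝ → ℝ} {s : Set ℝ} (hf : MonotoneOn f s)
    (hs : ∀ x ∈ s, f x ∈ Icc (0 : ℝ) 1) :
    ∃ F : ℝ → ℝ, Monotone F ∧ (∀ x, F x ∈ Icc (0 : ℝ) 1) ∧ ∀ x ∈ s, f x = F x := by
  obtain ⟨F, hF, hfF⟩ := hf.exists_monotone_extension
    ⟨0, by rintro _ ⟨x, hx, rfl⟩; exact (hs x hx).1⟩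
    ⟨1, by rintro _ ⟨x, hx, rfl⟩; exact (hs x hx).2⟩
  refine ⟨fun x => max 0 (min 1 (F x)), fun x y h => ?_, fun x => ⟨le_max_left _ _, ?_⟩,
    fun x hx => ?_⟩
  · exact max_le_max le_rfl (min_le_min le_rfl (hF h))
  · exact max_le zero_le_one (min_le_left _ _)
  · have := hs x hx
    rw [hfF hx] at this ⊢
    simp only
    rw [min_eq_right this.2, max_eq_right this.1]

theorem exists_slope_bound {f : ℝ → ℝ} (hf : ∀ x, f x ∈ Icc (0 : ℝ) 1) {x : ℝ}
    (hx : DifferentiableAt ℝ f x) : ∃ M : ℝ, 0 ≤ M ∧ ∀ y, |f y - f x| ≤ M * |y - x| := by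
  obtain ⟨C, hC⟩ := hx.hasDerivAt.isBigO_sub.bound
  obtain ⟨δ, hδ, h⟩ := Metric.eventually_nhds_iff.1 hC
  refine ⟨max C δ⁻¹, le_max_of_le_right (inv_nonneg.2 hδ.le), fun y => ?_⟩
  by_cases hy : dist y x < δ
  · refine (h hy).trans ?_
    rw [Real.norm_eq_abs]
    gcongr
    exact le_max_left _ _
  · rw [Real.dist_eq, not_lt] at hy
    have h1 : |f y - f x| ≤ 1 := by
      rw [abs_le]
      constructor <;> linarith [(hf x).1, (hf x).2, (hf y).1, (hf y).2]
    have h2 : 1 ≤ δ⁻¹ * |y - x| := by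
      rw [← inv_mul_cancel₀ hδ.ne']
      gcongr
    refine h1.trans (h2.trans ?_)
    gcongr
    exact le_max_right _ _

/-- A measurable set of positive area in the plane meets a countable increasing union of
sets `F n ∩ R n` in positive measure, provided the `F n` are measurable and exhaust almost every
vertical slice, and the `R n` exhaust almost every horizontal slice. -/
theorem exists_measure_inter_ne_zero {A B : Set ℝ} (hA : MeasurableSet A) (hB : MeasurableSet B)
    (hA0 : volume A ≠ 0) (hB0 : volume B ≠ 0) {F R : ℕ → Set (ℝ × ℝ)}
    (hF : ∀ n, MeasurableSet (F n)) (hFm : Monotone F) (hRm : Monotone R)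
    (hFs : ∀ a ∈ A, ∀ᵐ b, b ∈ B → ∃ n, (a, b) ∈ F n)
    (hRs : ∀ b ∈ B, ∀ᵐ a, a ∈ A → ∃ n, (a, b) ∈ R n) :
    ∃ n, volume ((A ×ˢ B) ∩ F n ∩ R n) ≠ 0 := by
  by_contra! h
  have hN : volume (toMeasurable volume (⋃ n, (A ×ˢ B) ∩ F n ∩ R n)) = 0 := by
    rw [measure_toMeasurable]
    exact measure_iUnion_null h
  have hP : volume ((A ×ˢ B) \ ⋃ n, F n) = 0 := by
    rw [Measure.volume_eq_prod, Measure.measure_prod_null ((hA.prod hB).diff (.iUnion hF))]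
    refine Eventually.of_forall fun a => ?_
    by_cases ha : a ∈ A
    · refine measure_mono_null ?_ (hFs a ha)
      rintro b ⟨⟨-, hb⟩, hn⟩ h'
      exact hn (mem_iUnion.2 (h' hb))
    · have : Prod.mk a ⁻¹' ((A ×ˢ B) \ ⋃ n, F n) = ∅ :=
        eq_empty_of_forall_notMem fun b hb => ha hb.1.1
      exact (congrArg volume this).trans measure_empty
  have hQ : volume (((A ×ˢ B) ∩ ⋃ n, F n) \
      toMeasurable volume (⋃ n, (A ×ˢ B) ∩ F n ∩ R n)) = 0 := by
    rw [Measure.volume_eq_prod, Measure.prod_apply_symm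
      (((hA.prod hB).inter (.iUnion hF)).diff (measurableSet_toMeasurable _ _))]
    rw [lintegral_eq_zero_iff' (measurable_measure_prodMk_right
      (((hA.prod hB).inter (.iUnion hF)).diff (measurableSet_toMeasurable _ _))).aemeasurable]
    refine Eventually.of_forall fun b => ?_
    by_cases hb : b ∈ B
    · refine measure_mono_null ?_ (hRs b hb)
      rintro a ⟨⟨hab, hF'⟩, hn⟩ h'
      obtain ⟨n, hn'⟩ := mem_iUnion.1 hF'
      obtain ⟨m, hm⟩ := h' hab.1
      exact hn (subset_toMeasurable _ _ (mem_iUnion.2 ⟨max n m,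
        ⟨hab, hFm (le_max_left _ _) hn'⟩, hRm (le_max_right _ _) hm⟩))
    · have : (fun a => (a, b)) ⁻¹' (((A ×ˢ B) ∩ ⋃ n, F n) \
          toMeasurable volume (⋃ n, (A ×ˢ B) ∩ F n ∩ R n)) = ∅ :=
        eq_empty_of_forall_notMem fun a ha => hb ha.1.1.2
      exact (congrArg volume this).trans measure_empty
  have : volume (A ×ˢ B) = 0 := by
    refine measure_mono_null ?_ (measure_union_null hN (measure_union_null hP hQ))
    intro p hp
    by_cases h1 : p ∈ toMeasurable volume (⋃ n, (A ×ˢ B) ∩ F n ∩ R n)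
    · exact Or.inl h1
    by_cases h2 : p ∈ ⋃ n, F n
    · exact Or.inr (Or.inr ⟨⟨hp, h2⟩, h1⟩)
    · exact Or.inr (Or.inl ⟨hp, h2⟩)
  rw [Measure.volume_eq_prod, Measure.prod_prod, mul_eq_zero] at this
  exact this.elim hA0 hB0

/-- If the points `g a b` run monotonically along Lipschitz curves in each variable
separately, then a limit of `g` is Lipschitz on a set of positive measure. -/
theorem exists_lipschitzOn_grid {K : Set X} (hK : IsCompact K) {u v : X → ℝ}
    (hu : Continuous u) (hv : Continuous v) {L : ℝ} {A B : Set ℝ} {g : ℝ → ℝ → X}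
    (hA : MeasurableSet A) (hB : MeasurableSet B) (hA0 : volume A ≠ 0) (hB0 : volume B ≠ 0)
    (hg : ∀ a ∈ A, ∀ b ∈ B, g a b ∈ K ∧ u (g a b) = a ∧ v (g a b) = b)
    (hrow : ∀ b ∈ B, ∃ (c : ℝ → X) (τ : ℝ → ℝ), (∀ s t, dist (c s) (c t) ≤ L * |s - t|) ∧
      MonotoneOn τ A ∧ (∀ a ∈ A, τ a ∈ Icc (0 : ℝ) 1) ∧ ∀ a ∈ A, g a b = c (τ a))
    (hcol : ∀ a ∈ A, ∃ (c : ℝ → X) (τ : ℝ → ℝ), (∀ s t, dist (c s) (c t) ≤ L * |s - t|) ∧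
      MonotoneOn τ B ∧ (∀ b ∈ B, τ b ∈ Icc (0 : ℝ) 1) ∧ ∀ b ∈ B, g a b = c (τ b)) :
    ∃ (E : Set (ℝ × ℝ)) (f : ℝ × ℝ → X) (C : ℝ≥0), volume E ≠ 0 ∧ LipschitzOnWith C f E ∧
      ∀ p ∈ E, u (f p) = p.1 ∧ v (f p) = p.2 := by
  have hBne : B.Nonempty := nonempty_of_measure_ne_zero hB0
  have : Nonempty B := hBne.to_subtype
  have hL : 0 ≤ L := by
    obtain ⟨b, hb⟩ := hBne
    obtain ⟨c, -, hc, -⟩ := hrow b hb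
    simpa using dist_nonneg.trans (hc 1 0)
  let d : ℕ → ℝ := fun k => (TopologicalSpace.denseSeq B k : ℝ)
  have hd : ∀ k, d k ∈ B := fun k => (TopologicalSpace.denseSeq B k).2
  have hdB : B ⊆ closure (range d) := by
    intro b hb
    have h := TopologicalSpace.denseRange_denseSeq B ⟨b, hb⟩
    rw [Topology.IsEmbedding.subtypeVal.closure_eq_preimage_closure_image, ← range_comp] at h
    exact h
  let j : ℕ → ℝ → ℕ := fun k b => SimpleFunc.nearestPtInd d k b
  have hj : ∀ k, Measurable (j k) := fun k => (SimpleFunc.nearestPtInd d k).measurable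
  have hdj : ∀ b ∈ B, Tendsto (fun k => d (j k b)) atTop (𝓝 b) := fun b hb =>
    SimpleFunc.tendsto_nearestPt (hdB hb)
  choose c τ hc hτm hτI hgc using fun k => hrow (d k) (hd k)
  choose T hTm hTI hTeq using fun k => exists_monotone_extension_Icc (hτm k) (hτI k)
  have hG : ∀ k, ∀ a ∈ A, g a (d k) = c k (T k a) := fun k a ha => by
    rw [hgc k a ha, hTeq k a ha]
  have hcc : ∀ k, Continuous (c k) := fun k =>
    (LipschitzWith.of_dist_le_mul (K := L.toNNReal) fun s t => by
      rw [Real.coe_toNNReal L hL, Real.dist_eq]; exact hc k s t).continuous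
  have hex : ∀ p : ℝ × ℝ, ∃ x, p.1 ∈ A →
      Tendsto (fun k => g p.1 (d (j k p.2))) (hyperfilter ℕ : Filter ℕ) (𝓝 x) := by
    intro p
    by_cases hp : p.1 ∈ A
    · obtain ⟨x, hx⟩ := exists_ultrafilter_limit hK
        (fun k (_ : Unit) => g p.1 (d (j k p.2))) fun k _ => (hg _ hp _ (hd _)).1
      exact ⟨x (), fun _ => (hx ()).2⟩
    · exact ⟨g 0 0, fun h => absurd h hp⟩
  choose f hf using hex
  let F : ℕ → Set (ℝ × ℝ) := fun n => {p | ∀ i, ∃ k₀, ∀ k, k₀ ≤ k →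
    dist (c (j k p.2) (T (j k p.2) p.1)) (c i (T i p.1)) ≤ n * |p.2 - d i|}
  let R : ℕ → Set (ℝ × ℝ) := fun n => {p | ∀ a ∈ A, dist (f p) (f (a, p.2)) ≤ n * |p.1 - a|}
  have hFmeas : ∀ n, MeasurableSet (F n) := by
    intro n
    simp only [F, ofPred_forall, ofPred_exists]
    refine .iInter fun i => .iUnion fun k₀ => .iInter fun k => .iInter fun _ =>
      measurableSet_le ?_ ?_
    · have : Measurable fun q : ℝ × ℕ => dist (c q.2 (T q.2 q.1)) (c i (T i q.1)) := by
        refine measurable_from_prod_countable_left fun m => ?_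
        have h1 : Continuous fun q : ℝ × ℝ => dist (c m q.1) (c i q.2) :=
          ((hcc m).comp continuous_fst).dist ((hcc i).comp continuous_snd)
        exact h1.measurable.comp ((hTm m).measurable.prodMk (hTm i).measurable)
      exact this.comp (measurable_fst.prodMk ((hj k).comp measurable_snd))
    · exact ((measurable_snd.sub_const _).abs).const_mul _
  have hFmono : Monotone F := by
    intro n m hnm p hp i
    obtain ⟨k₀, hk⟩ := hp i
    refine ⟨k₀, fun k hk' => (hk k hk').trans ?_⟩
    gcongr
  have hRmono : Monotone R := by
    intro n m hnm p hp a ha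
    refine (hp a ha).trans ?_
    gcongr
  have hFs : ∀ a ∈ A, ∀ᵐ b, b ∈ B → ∃ n, (a, b) ∈ F n := by
    intro a ha
    obtain ⟨c', τ', hc', hτm', hτI', hgc'⟩ := hcol a ha
    obtain ⟨S, hSm, hSI, hSeq⟩ := exists_monotone_extension_Icc hτm' hτI'
    filter_upwards [hSm.ae_differentiableAt,
      (countable_range d).ae_notMem volume] with b hb hbd hbB
    obtain ⟨M, hM, hSM⟩ := exists_slope_bound hSI hb
    obtain ⟨n, hn⟩ := exists_nat_ge (L * (2 * M))
    refine ⟨n, fun i => ?_⟩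
    have hpos : 0 < |b - d i| := abs_pos.2 (sub_ne_zero.2 fun h => hbd ⟨i, h.symm⟩)
    obtain ⟨k₀, hk₀⟩ := Metric.tendsto_atTop.1 (hdj b hbB) _ hpos
    refine ⟨k₀, fun k hk => ?_⟩
    have h1 := hk₀ k hk
    rw [Real.dist_eq] at h1
    simp only
    rw [← hG _ a ha, ← hG _ a ha, hgc' _ (hd _), hgc' _ (hd _), hSeq _ (hd _), hSeq _ (hd _)]
    calc _ ≤ L * |S (d (j k b)) - S (d i)| := hc' _ _
      _ ≤ L * (M * |b - d i| + M * |b - d i|) := by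
        gcongr
        refine (abs_sub_le _ (S b) _).trans (add_le_add ((hSM _).trans ?_) ?_)
        · gcongr
        · rw [abs_sub_comm, abs_sub_comm b]
          exact hSM _
      _ = L * (2 * M) * |b - d i| := by ring
      _ ≤ n * |b - d i| := by gcongr
  have hRs : ∀ b ∈ B, ∀ᵐ a, a ∈ A → ∃ n, (a, b) ∈ R n := by
    intro b hb
    obtain ⟨S, hS⟩ := exists_ultrafilter_limit isCompact_Icc (fun k a => T (j k b) a)
      fun k a => hTI _ a
    have hSm : Monotone S := fun a a' h =>
      le_of_tendsto_of_tendsto' (hS a).2 (hS a').2 fun k => hTm _ h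
    filter_upwards [hSm.ae_differentiableAt] with a hda ha
    obtain ⟨M, hM, hSM⟩ := exists_slope_bound (fun x => (hS x).1) hda
    obtain ⟨n, hn⟩ := exists_nat_ge (L * M)
    refine ⟨n, fun a' ha' => ?_⟩
    calc dist (f (a, b)) (f (a', b)) ≤ L * |S a - S a'| := by
          refine le_of_tendsto_of_tendsto' ((hf (a, b) ha).dist (hf (a', b) ha'))
            (((hS a).2.sub (hS a').2).abs.const_mul L) fun k => ?_
          rw [hG _ a ha, hG _ a' ha']
          exact hc _ _ _
      _ ≤ L * (M * |a - a'|) := by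
        gcongr
        rw [abs_sub_comm, abs_sub_comm a]
        exact hSM _
      _ = L * M * |a - a'| := by ring
      _ ≤ n * |a - a'| := by gcongr
  obtain ⟨n, hn⟩ := exists_measure_inter_ne_zero hA hB hA0 hB0 hFmeas hFmono hRmono hFs hRs
  have hlim : ∀ p ∈ A ×ˢ B, u (f p) = p.1 ∧ v (f p) = p.2 := by
    intro p hp
    have h := hf p hp.1
    constructor
    · refine tendsto_nhds_unique ((hu.tendsto _).comp h) (tendsto_const_nhds.congr fun k => ?_)
      exact ((hg _ hp.1 _ (hd _)).2.1).symm
    · refine tendsto_nhds_unique ((hv.tendsto _).comp h)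
        (((hdj _ hp.2).mono_left hyperfilter_le_atTop).congr fun k => ?_)
      exact ((hg _ hp.1 _ (hd _)).2.2).symm
  have hvert : ∀ a b b', a ∈ A → b ∈ B → (a, b') ∈ F n →
      dist (f (a, b')) (f (a, b)) ≤ n * |b' - b| := by
    intro a b b' ha hb hF
    have h1 : ∀ i, dist (f (a, b')) (g a (d i)) ≤ n * |b' - d i| := by
      intro i
      obtain ⟨k₀, hk₀⟩ := hF i
      refine le_of_tendsto ((hf (a, b') ha).dist tendsto_const_nhds) (hyperfilter_le_atTop ?_)
      filter_upwards [eventually_ge_atTop k₀] with k hk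
      rw [hG _ a ha, hG _ a ha]
      exact hk₀ k hk
    exact le_of_tendsto_of_tendsto' (tendsto_const_nhds.dist (hf (a, b) ha))
      ((tendsto_const_nhds.sub ((hdj b hb).mono_left hyperfilter_le_atTop)).abs.const_mul (n : ℝ))
      fun k => h1 _
  refine ⟨_, f, 2 * n, hn, LipschitzOnWith.of_dist_le_mul ?_, fun p hp => hlim p hp.1.1⟩
  rintro ⟨a, b⟩ ⟨⟨hab, -⟩, hR⟩ ⟨a', b'⟩ ⟨⟨hab', hF⟩, -⟩
  calc dist (f (a, b)) (f (a', b')) ≤ dist (f (a, b)) (f (a', b)) + dist (f (a', b)) (f (a', b')) :=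
        dist_triangle _ _ _
    _ ≤ n * |a - a'| + n * |b - b'| := by
      refine add_le_add (hR a' hab'.1) ?_
      rw [dist_comm, abs_sub_comm]
      exact hvert a' b b' hab'.1 hab.2 hF
    _ ≤ n * dist (a, b) (a', b') + n * dist (a, b) (a', b') := by
      rw [Prod.dist_eq, Real.dist_eq, Real.dist_eq]
      gcongr
      · exact le_max_left _ _
      · exact le_max_right _ _
    _ = ((2 * n : ℝ≥0) : ℝ) * dist (a, b) (a', b') := by push_cast; ring

end Grid

section Square

open unitInterval

theorem exists_small_square {X : Type*} [TopologicalSpace X] (φ : X ≃ₜ E2) {U : Set X}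
    (hU : U ∈ 𝓝 (φ.symm 0)) :
    ∃ e : I × I → X, Continuous e ∧ Function.Injective e ∧ range e ⊆ U := by
  obtain ⟨δ, hδ, hball⟩ := Metric.mem_nhds_iff.1
    (φ.symm.continuous.continuousAt.preimage_mem_nhds hU)
  refine ⟨fun p => φ.symm ((δ / 4) • !₂[(p.1 : ℝ), (p.2 : ℝ)]), ?_, ?_, ?_⟩
  · exact φ.symm.continuous.comp (by fun_prop)
  · intro p q h
    have h1 := smul_right_injective E2 (div_pos hδ four_pos).ne' (φ.symm.injective h)
    have h2 := congrArg (fun w : E2 => w 0) h1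
    have h3 := congrArg (fun w : E2 => w 1) h1
    exact Prod.ext (Subtype.ext h2) (Subtype.ext h3)
  · rintro _ ⟨⟨s, t⟩, rfl⟩
    refine hball ?_
    have h1 : ‖(!₂[(s : ℝ), (t : ℝ)] : E2)‖ ≤ 2 := by
      rw [EuclideanSpace.norm_eq, Real.sqrt_le_iff]
      simp only [Fin.sum_univ_two, Real.norm_eq_abs, sq_abs]
      refine ⟨zero_le_two, ?_⟩
      change (s : ℝ) ^ 2 + (t : ℝ) ^ 2 ≤ 2 ^ 2
      nlinarith [s.2.1, s.2.2, t.2.1, t.2.2]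
    rw [mem_ball_zero_iff, norm_smul, Real.norm_of_nonneg (by positivity)]
    calc δ / 4 * ‖(!₂[(s : ℝ), (t : ℝ)] : E2)‖ ≤ δ / 4 * 2 := by gcongr
      _ < δ := by linarith

/-- The distance from a compact set is bounded below on a disjoint compact set. -/
theorem exists_lt_infDist {X : Type*} [MetricSpace X] {P Q : Set X} (hP : IsClosed P)
    (hPne : P.Nonempty) (hQ : IsCompact Q) (hQne : Q.Nonempty) (hPQ : Disjoint P Q) :
    ∃ ε : ℝ, 0 < ε ∧ ∀ x ∈ Q, ε < infDist x P := by
  obtain ⟨y, hy, hmin⟩ := hQ.exists_isMinOn hQne (continuous_infDist_pt P).continuousOn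
  have hpos := (hP.notMem_iff_infDist_pos hPne).1 (Set.disjoint_right.1 hPQ hy)
  exact ⟨infDist y P / 2, half_pos hpos, fun x hx => (half_lt_self hpos).trans_le (hmin hx)⟩

end Square

/-- Corollary 1.5: existence of a 2-rectifiable subset of positive measure. -/
theorem exists_rectifiable_subset
    {X : Type*} [MetricSpace X] [MeasurableSpace X] [BorelSpace X]
    (hgeo : IsLocallyGeodesicSpace X)
    (hhomeo : Nonempty (X ≃ₜ E2))
    (hfin : ∀ x : X, ∃ U ∈ nhds x, μH[2] U ≠ ⊤) :
    ∃ S : Set X, Is2Rectifiable S ∧ 0 < μH[2] S := by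
  obtain ⟨φ⟩ := hhomeo
  obtain ⟨U, hU, hUfin⟩ := hfin (φ.symm 0)
  obtain ⟨e, he, hinj, heU⟩ := exists_small_square φ hU
  have hc1 : ∀ s : unitInterval, Continuous fun t => e (s, t) := fun s => by fun_prop
  have hc2 : ∀ t : unitInterval, Continuous fun s => e (s, t) := fun t => by fun_prop
  obtain ⟨ε₁, hε₁, h₁⟩ := exists_lt_infDist (isCompact_range (hc1 0)).isClosed (range_nonempty _)
    (isCompact_range (hc1 1)) (range_nonempty _) (by
      rw [Set.disjoint_left]
      rintro _ ⟨t, rfl⟩ ⟨t', h⟩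
      exact one_ne_zero (congrArg Prod.fst (hinj h)))
  obtain ⟨ε₂, hε₂, h₂⟩ := exists_lt_infDist (isCompact_range (hc2 0)).isClosed (range_nonempty _)
    (isCompact_range (hc2 1)) (range_nonempty _) (by
      rw [Set.disjoint_left]
      rintro _ ⟨t, rfl⟩ ⟨t', h⟩
      exact one_ne_zero (congrArg Prod.snd (hinj h)))
  have hu := lipschitz_infDist_pt (range fun t => e (0, t))
  have hv := lipschitz_infDist_pt (range fun s => e (s, 0))
  obtain ⟨L, A, B, g, -, -, hA, hB, hA0, hB0, hg, hrow, hcol⟩ := exists_transversal_families he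
    hinj (measure_ne_top_of_subset heU hUfin) hu hv
    (lt_min hε₁ hε₂) (fun t => infDist_zero_of_mem (mem_range_self t))
    (fun t => (min_le_left _ _).trans_lt (h₁ _ (mem_range_self t)))
    (fun s => infDist_zero_of_mem (mem_range_self s))
    (fun s => (min_le_right _ _).trans_lt (h₂ _ (mem_range_self s)))
  obtain ⟨E, f, C, hE, hf, huv⟩ := exists_lipschitzOn_grid (isCompact_range he) hu.continuous
    hv.continuous hA hB hA0 hB0 hg hrow hcol
  have hproj : LipschitzWith 1 fun w : E2 => (w 0, w 1) :=
    LipschitzWith.of_dist_le_mul fun w z => by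
      rw [Prod.dist_eq, NNReal.coe_one, one_mul, max_le_iff]
      exact ⟨PiLp.dist_apply_le w z 0, PiLp.dist_apply_le w z 1⟩
  refine ⟨f '' E, ⟨fun _ => {w | (w 0, w 1) ∈ E}, fun _ w => f (w 0, w 1), fun _ => ⟨C, ?_⟩, ?_⟩,
    ?_⟩
  · have h := hf.comp (s := {w : E2 | (w 0, w 1) ∈ E}) hproj.lipschitzOnWith fun w hw => hw
    rwa [mul_one] at h
  · have : f '' E ⊆ ⋃ _ : ℕ, (fun w : E2 => f (w 0, w 1)) '' {w | (w 0, w 1) ∈ E} := by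
      rintro _ ⟨p, hp, rfl⟩
      exact mem_iUnion.2 ⟨0, !₂[p.1, p.2], hp, rfl⟩
    rw [sdiff_eq_empty.2 this, measure_empty]
  · have hmap : LipschitzWith 1 fun x => (infDist x (range fun t => e (0, t)),
        infDist x (range fun s => e (s, 0))) := by
      simpa using hu.prodMk hv
    have himg : (fun x => (infDist x (range fun t => e (0, t)),
        infDist x (range fun s => e (s, 0)))) '' (f '' E) = E := by
      rw [image_image]
      exact (image_congr fun p hp => Prod.ext (huv p hp).1 (huv p hp).2).trans (image_id E)
    have hle := hmap.hausdorffMeasure_image_le zero_le_two (f '' E)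
    rw [himg, hausdorffMeasure_prod_real, ENNReal.coe_one, ENNReal.one_rpow, one_mul] at hle
    exact (pos_iff_ne_zero.2 hE).trans_le hle

end
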